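/- arXiv:2310.04962 — 5 statements merged into one kernel-verified Lean document; each statement's English description precedes it below -/
import Mathlib

section
/- Let ε > 0 and let K^c_{n,n} be an edge-colored complete balanced bipartite graph with parts X and Y satisfying δ^c(K^c_{n,n}) ≥ (2/3 + ε)n and n ≥ 4/ε. Then for every four distinct vertices x_1, x_2 ∈ X and y_1, y_2 ∈ Y, the number of absorbing paths for (x_1, y_1; x_2, y_2) is at least (16/9)ε² n⁴. -/
open SimpleGraph

/-- Vertex type of `K_{n,n}`: left part `X`, right part `Y`. -/
abbrev V2 (n : ℕ) := Fin n ⊕ Fin n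

/-- The complete balanced bipartite graph `K_{n,n}`. -/
def KBB (n : ℕ) : SimpleGraph (V2 n) := completeBipartiteGraph (Fin n) (Fin n)

/-- The color degree of a vertex: the number of distinct colors on its incident edges. -/
def colorDeg (n : ℕ) (c : V2 n → V2 n → ℕ) : V2 n → ℕ
  | Sum.inl x => ((Finset.univ : Finset (Fin n)).image fun j => c (Sum.inl x) (Sum.inr j)).card
  | Sum.inr y => ((Finset.univ : Finset (Fin n)).image fun i => c (Sum.inr y) (Sum.inl i)).card

/-- The minimum color degree `δ^c`. -/
noncomputable def minColorDeg (n : ℕ) (c : V2 n → V2 n → ℕ) : ℕ :=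
  ⨅ v : V2 n, colorDeg n c v

/-- `Δ_mon(v)`: the maximum number of same-colored edges incident to `v`. -/
def monDeg (n : ℕ) (c : V2 n → V2 n → ℕ) : V2 n → ℕ
  | Sum.inl x => Finset.univ.sup fun j : Fin n =>
      (Finset.univ.filter fun j' : Fin n =>
        c (Sum.inl x) (Sum.inr j') = c (Sum.inl x) (Sum.inr j)).card
  | Sum.inr y => Finset.univ.sup fun i : Fin n =>
      (Finset.univ.filter fun i' : Fin n =>
        c (Sum.inr y) (Sum.inl i') = c (Sum.inr y) (Sum.inl i)).card

/-- A subgraph is properly colored: adjacent edges receive distinct colors. -/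
def IsPCSubgraph (n : ℕ) (c : V2 n → V2 n → ℕ) (H : SimpleGraph (V2 n)) : Prop :=
  ∀ u v w, H.Adj u v → H.Adj u w → v ≠ w → c u v ≠ c u w

/-- Every cycle of `H` has length at least `t`. -/
def CyclesAtLeast {n : ℕ} (H : SimpleGraph (V2 n)) (t : ℕ) : Prop :=
  ∀ (v : V2 n) (p : H.Walk v v), p.IsCycle → t ≤ p.length

/-- A properly colored 2-factor of `K_{n,n}`: a spanning 2-regular properly colored
subgraph. -/
def IsPC2Factor (n : ℕ) (c : V2 n → V2 n → ℕ) (H : SimpleGraph (V2 n)) : Prop :=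
  H ≤ KBB n ∧ (∀ v, (H.neighborSet v).ncard = 2) ∧ IsPCSubgraph n c H

/-- A properly colored `2^{(t)}`-factor of the induced subgraph on `S`. -/
def IsPC2FactorOn (n : ℕ) (c : V2 n → V2 n → ℕ) (S : Set (V2 n))
    (H : SimpleGraph (V2 n)) (t : ℕ) : Prop :=
  H ≤ KBB n ∧ (∀ u v, H.Adj u v → u ∈ S) ∧ (∀ v ∈ S, (H.neighborSet v).ncard = 2) ∧
    IsPCSubgraph n c H ∧ CyclesAtLeast H t

/-- A properly colored cycle of length `k` in `K_{n,n}`, given as an injective cyclic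
sequence of vertices with adjacent edges having distinct colors. -/
def IsPCCycle (n : ℕ) (c : V2 n → V2 n → ℕ) (k : ℕ) (f : ZMod k → V2 n) : Prop :=
  Function.Injective f ∧ (∀ i, (KBB n).Adj (f i) (f (i + 1))) ∧
    ∀ i, c (f i) (f (i + 1)) ≠ c (f (i + 1)) (f (i + 2))

/-- Consecutive edges of the vertex list receive distinct colors. -/
def PCL (n : ℕ) (c : V2 n → V2 n → ℕ) : List (V2 n) → Prop
  | a :: b :: d :: rest => c a b ≠ c b d ∧ PCL n c (b :: d :: rest)
  | _ => True

/-- A properly colored path in `K_{n,n}` given by its list of vertices. -/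
def IsPCPath (n : ℕ) (c : V2 n → V2 n → ℕ) (l : List (V2 n)) : Prop :=
  l ≠ [] ∧ l.Nodup ∧ l.Chain' (KBB n).Adj ∧ PCL n c l

/-- A properly colored odd path: odd number of edges, i.e. an even number of vertices,
equivalently one endpoint in each part. -/
def IsPCOddPath (n : ℕ) (c : V2 n → V2 n → ℕ) (l : List (V2 n)) : Prop :=
  IsPCPath n c l ∧ Even l.length

/-- A properly colored 3-path `x' y' x'' y''` with `x', x'' ∈ X` and `y', y'' ∈ Y`,
encoded as the quadruple `(x', y', x'', y'')`. -/
def IsPC3Path (n : ℕ) (c : V2 n → V2 n → ℕ) : Fin n × Fin n × Fin n × Fin n → Prop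
  | (a, b, a', b') =>
    a ≠ a' ∧ b ≠ b' ∧
      c (Sum.inl a) (Sum.inr b) ≠ c (Sum.inr b) (Sum.inl a') ∧
      c (Sum.inr b) (Sum.inl a') ≠ c (Sum.inl a') (Sum.inr b')

/-- An absorbing path `x' y' x'' y''` for the pair `(x, y)`: a PC 3-path avoiding
`{x, y}` such that `x' y' x y x'' y''` is a properly colored path. -/
def IsAbsorbingPath1 (n : ℕ) (c : V2 n → V2 n → ℕ) (x y : Fin n) :
    Fin n × Fin n × Fin n × Fin n → Prop
  | (a, b, a', b') =>
    IsPC3Path n c (a, b, a', b') ∧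
      a ≠ x ∧ a' ≠ x ∧ b ≠ y ∧ b' ≠ y ∧
      c (Sum.inl a) (Sum.inr b) ≠ c (Sum.inr b) (Sum.inl x) ∧
      c (Sum.inr b) (Sum.inl x) ≠ c (Sum.inl x) (Sum.inr y) ∧
      c (Sum.inl x) (Sum.inr y) ≠ c (Sum.inr y) (Sum.inl a') ∧
      c (Sum.inr y) (Sum.inl a') ≠ c (Sum.inl a') (Sum.inr b')

/-- An absorbing path `x' y' x'' y''` for the quadruple `(x₁, y₁; x₂, y₂)`: a PC 3-path
avoiding `{x₁, y₁, x₂, y₂}` such that the paths `x' y' x₁ y₁` and `y'' x'' y₂ x₂`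
are properly colored. -/
def IsAbsorbingPath2 (n : ℕ) (c : V2 n → V2 n → ℕ) (x₁ y₁ x₂ y₂ : Fin n) :
    Fin n × Fin n × Fin n × Fin n → Prop
  | (a, b, a', b') =>
    IsPC3Path n c (a, b, a', b') ∧
      a ≠ x₁ ∧ a ≠ x₂ ∧ a' ≠ x₁ ∧ a' ≠ x₂ ∧ b ≠ y₁ ∧ b ≠ y₂ ∧ b' ≠ y₁ ∧ b' ≠ y₂ ∧
      c (Sum.inl a) (Sum.inr b) ≠ c (Sum.inr b) (Sum.inl x₁) ∧
      c (Sum.inr b) (Sum.inl x₁) ≠ c (Sum.inl x₁) (Sum.inr y₁) ∧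
      c (Sum.inr b') (Sum.inl a') ≠ c (Sum.inl a') (Sum.inr y₂) ∧
      c (Sum.inl a') (Sum.inr y₂) ≠ c (Sum.inr y₂) (Sum.inl x₂)

/-- Two 3-paths (as quadruples) are vertex-disjoint. -/
def QuadDisjoint {n : ℕ} (P Q : Fin n × Fin n × Fin n × Fin n) : Prop :=
  P.1 ≠ Q.1 ∧ P.1 ≠ Q.2.2.1 ∧ P.2.2.1 ≠ Q.1 ∧ P.2.2.1 ≠ Q.2.2.1 ∧
    P.2.1 ≠ Q.2.1 ∧ P.2.1 ≠ Q.2.2.2 ∧ P.2.2.2 ≠ Q.2.1 ∧ P.2.2.2 ≠ Q.2.2.2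

/-- A `1^{(t)}`-path-cycle: a vertex-disjoint union of exactly one PC path and a
(possibly empty) collection of PC cycles, each cycle of length at least `t`. -/
structure OnePathCycleT (n : ℕ) (c : V2 n → V2 n → ℕ) (t : ℕ) where
  path : List (V2 n)
  path_pc : IsPCPath n c path
  numCycles : ℕ
  cycLen : Fin numCycles → ℕ
  cyc : (i : Fin numCycles) → ZMod (cycLen i) → V2 n
  cyc_pc : ∀ i, IsPCCycle n c (cycLen i) (cyc i)
  cyc_long : ∀ i, t ≤ cycLen i
  disj_path_cyc : ∀ i j, cyc i j ∉ path
  disj_cyc_cyc : ∀ i i', i ≠ i' → ∀ j j', cyc i j ≠ cyc i' j'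

/-- The vertex set of a `1^{(t)}`-path-cycle. -/
def OnePathCycleT.verts {n : ℕ} {c : V2 n → V2 n → ℕ} {t : ℕ}
    (H : OnePathCycleT n c t) : Set (V2 n) :=
  {v | v ∈ H.path} ∪ ⋃ i, Set.range (H.cyc i)

/-- Avoiding two values of `f` and one point of its domain loses at most three of the values
attained by `f`. -/
lemma card_image_le_card_filter_add_three {α β : Type*} [Fintype α] [DecidableEq α]
    [DecidableEq β] (f : α → β) (k₁ k₂ : β) (w : α) :
    (Finset.univ.image f).card ≤
      (Finset.univ.filter fun j => f j ≠ k₁ ∧ f j ≠ k₂ ∧ j ≠ w).card + 3 := by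
  set S := Finset.univ.filter fun j => f j ≠ k₁ ∧ f j ≠ k₂ ∧ j ≠ w with hS
  have hsub : Finset.univ.image f ⊆ S.image f ∪ {k₁, k₂, f w} := by
    intro y hy
    obtain ⟨j, -, rfl⟩ := Finset.mem_image.1 hy
    by_cases hj : j ∈ S
    · exact Finset.mem_union_left _ (Finset.mem_image_of_mem f hj)
    · apply Finset.mem_union_right
      simp only [hS, Finset.mem_filter, Finset.mem_univ, true_and] at hj
      simp only [Finset.mem_insert, Finset.mem_singleton]
      grind
  calc (Finset.univ.image f).card ≤ (S.image f ∪ {k₁, k₂, f w}).card := Finset.card_le_card hsub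
    _ ≤ (S.image f).card + ({k₁, k₂, f w} : Finset β).card := Finset.card_union_le _ _
    _ ≤ S.card + 3 := add_le_add Finset.card_image_le Finset.card_le_three

/-- If `B` and `A` have at least `m` elements, and each pair in `B × A` extends in at least `m`
ways on either side, then there are at least `m ^ 4` extended quadruples. -/
lemma pow_four_le_ncard {α : Type*} [Finite α] (m : ℕ) (B A : Finset α)
    (L R : α → α → Finset α) (T : Set (α × α × α × α)) (hB : m ≤ B.card) (hA : m ≤ A.card)
    (hL : ∀ b a, m ≤ (L b a).card) (hR : ∀ b a, m ≤ (R b a).card)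
    (hT : ∀ b ∈ B, ∀ a' ∈ A, ∀ a ∈ L b a', ∀ b' ∈ R b a', (a, b, a', b') ∈ T) :
    m ^ 4 ≤ T.ncard := by
  classical
  let Q : Finset ((_ : α × α) × (α × α)) :=
    (B ×ˢ A).sigma fun p => L p.1 p.2 ×ˢ R p.1 p.2
  have hQ : m ^ 4 ≤ Q.card := by
    rw [Finset.card_sigma]
    calc m ^ 4 = (m * m) * (m * m) := by ring
      _ ≤ (B ×ˢ A).card * (m * m) := by
        rw [Finset.card_product]
        gcongr
      _ = ∑ _p ∈ B ×ˢ A, m * m := by simp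
      _ ≤ _ := Finset.sum_le_sum fun p _ => by
        rw [Finset.card_product]
        exact Nat.mul_le_mul (hL _ _) (hR _ _)
  refine hQ.trans ?_
  rw [← Set.ncard_coe_finset Q]
  refine Set.ncard_le_ncard_of_injOn (fun q => (q.2.1, q.1.1, q.1.2, q.2.2)) ?_ ?_ T.toFinite
  · rintro ⟨⟨b, a'⟩, a, b'⟩ hq
    simp only [Q, Finset.mem_coe, Finset.mem_sigma, Finset.mem_product] at hq
    exact hT b hq.1.1 a' hq.1.2 a hq.2.1 b' hq.2.2
  · rintro ⟨⟨b, a'⟩, a, b'⟩ - ⟨⟨d, e'⟩, e, d'⟩ - h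
    simp only [Prod.mk.injEq] at h
    obtain ⟨rfl, rfl, rfl, rfl⟩ := h
    rfl

/-- Lemma 3.4 (ii).  If `δ^c(K_{n,n}) ≥ (2/3 + ε)n` and `n ≥ 4/ε`, then for
all distinct `x₁, x₂ ∈ X` and distinct `y₁, y₂ ∈ Y` the number of absorbing paths for
`(x₁, y₁; x₂, y₂)` is at least `(16/9)ε²n⁴`. -/
theorem count_absorbing_paths_quadruple (n : ℕ) (ε : ℝ) (hε : 0 < ε)
    (c : V2 n → V2 n → ℕ) (hsym : ∀ u v, c u v = c v u)
    (hdeg : ∀ v, ((2 : ℝ) / 3 + ε) * n ≤ (colorDeg n c v : ℝ))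
    (hn : (4 : ℝ) / ε ≤ (n : ℝ))
    (x₁ x₂ y₁ y₂ : Fin n) (hx : x₁ ≠ x₂) (hy : y₁ ≠ y₂) :
    (16 : ℝ) / 9 * ε ^ 2 * (n : ℝ) ^ 4 ≤
      (({P : Fin n × Fin n × Fin n × Fin n |
        IsAbsorbingPath2 n c x₁ y₁ x₂ y₂ P}).ncard : ℝ) := by
  have hn0 : (0 : ℝ) < n := lt_of_lt_of_le (by positivity) hn
  have hεn : 4 ≤ ε * n := by
    rw [div_le_iff₀ hε] at hn
    linarith
  have hε3 : ε ≤ 1 / 3 := by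
    have h₁ : colorDeg n c (Sum.inl x₁) ≤ n := by
      simpa [colorDeg] using Finset.card_image_le (s := (Finset.univ : Finset (Fin n)))
        (f := fun j => c (Sum.inl x₁) (Sum.inr j))
    have h₂ : (2 / 3 + ε) * n ≤ 1 * (n : ℝ) := by
      rw [one_mul]
      exact (hdeg (Sum.inl x₁)).trans (by exact_mod_cast h₁)
    linarith [le_of_mul_le_mul_right h₂ hn0]
  set m : ℕ := ⌈(2 / 3 * n : ℝ)⌉₊ with hm
  have hcard : ∀ v k, colorDeg n c v ≤ k + 3 → m ≤ k := by
    intro v k hk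
    have hk' : (colorDeg n c v : ℝ) ≤ k + 3 := by exact_mod_cast hk
    refine Nat.ceil_le.2 ?_
    linarith [hdeg v]
  have hleft : ∀ (x : Fin n) (k₁ k₂ : ℕ) (w : Fin n), m ≤ (Finset.univ.filter fun j : Fin n =>
      c (Sum.inl x) (Sum.inr j) ≠ k₁ ∧ c (Sum.inl x) (Sum.inr j) ≠ k₂ ∧ j ≠ w).card :=
    fun x k₁ k₂ w => hcard (Sum.inl x) _ (card_image_le_card_filter_add_three _ k₁ k₂ w)
  have hright : ∀ (y : Fin n) (k₁ k₂ : ℕ) (w : Fin n), m ≤ (Finset.univ.filter fun i : Fin n =>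
      c (Sum.inr y) (Sum.inl i) ≠ k₁ ∧ c (Sum.inr y) (Sum.inl i) ≠ k₂ ∧ i ≠ w).card :=
    fun y k₁ k₂ w => hcard (Sum.inr y) _ (card_image_le_card_filter_add_three _ k₁ k₂ w)
  have hcount := pow_four_le_ncard m _ _ _ _
    {P : Fin n × Fin n × Fin n × Fin n | IsAbsorbingPath2 n c x₁ y₁ x₂ y₂ P}
    (hleft x₁ (c (Sum.inl x₁) (Sum.inr y₁)) (c (Sum.inl x₁) (Sum.inr y₁)) y₂)
    (hright y₂ (c (Sum.inr y₂) (Sum.inl x₂)) (c (Sum.inr y₂) (Sum.inl x₂)) x₁)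
    (fun b a' => hright b (c (Sum.inr b) (Sum.inl a')) (c (Sum.inr b) (Sum.inl x₁)) x₂)
    (fun b a' => hleft a' (c (Sum.inl a') (Sum.inr b)) (c (Sum.inl a') (Sum.inr y₂)) y₁)
    (by
      intro b hb a' ha' a ha b' hb'
      simp only [Finset.mem_filter, Finset.mem_univ, true_and] at hb ha' ha hb'
      simp only [Set.mem_ofPred_eq, IsAbsorbingPath2, IsPC3Path]
      rw [hsym (Sum.inl a) (Sum.inr b), hsym (Sum.inr b') (Sum.inl a'),
        hsym (Sum.inl a') (Sum.inr y₂), hsym (Sum.inr b) (Sum.inl x₁)]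
      rw [hsym (Sum.inr b) (Sum.inl x₁)] at ha
      rw [hsym (Sum.inl a') (Sum.inr y₂)] at hb'
      grind)
  have hpow : (2 / 3 * n : ℝ) ^ 4 ≤ (m : ℝ) ^ 4 := by
    gcongr
    exact Nat.le_ceil _
  calc (16 : ℝ) / 9 * ε ^ 2 * (n : ℝ) ^ 4 ≤ 16 / 9 * (1 / 3) ^ 2 * (n : ℝ) ^ 4 := by gcongr
    _ = (2 / 3 * n : ℝ) ^ 4 := by ring
    _ ≤ (m : ℝ) ^ 4 := hpow
    _ ≤ _ := by exact_mod_cast hcount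
end

section
/- Let 0 < γ < 1/2. There exists an integer n_0(γ) such that the following holds for every n ≥ n_0(γ) and every edge-colored complete balanced bipartite graph K^c_{n,n} with parts X and Y: if (x, y) with x ∈ X, y ∈ Y satisfies |𝒫(x, y)| ≥ γ n⁴ and (x_1, y_1; x_2, y_2) with distinct x_1, x_2 ∈ X and distinct y_1, y_2 ∈ Y satisfies |𝒫(x_1, y_1; x_2, y_2)| ≥ γ n⁴, then there exists a family ℱ of pairwise vertex-disjoint properly colored 3-paths such that |ℱ| ≤ 2⁻⁴ γ n, |ℱ ∩ 𝒫(x, y)| ≥ 2⁻⁷ γ² n, and |ℱ ∩ 𝒫(x_1, y_1; x_2, y_2)| ≥ 2⁻⁷ γ² n. -/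
open SimpleGraph

/-- Greedy extension: if each element conflicts with at most `d` elements, then a pairwise
compatible family `G` can be extended by `m` further elements of a large set `S`. -/
theorem exists_pairwise_superset_of_card_le {α : Type*} [DecidableEq α] {R : α → α → Prop}
    (hsymm : ∀ a b, R a b → R b a) (hirr : ∀ a, ¬ R a a) {B : α → Finset α} {d : ℕ}
    (hd : 0 < d) (hB : ∀ {a b}, b ∈ B a ↔ ¬ R a b) (hBd : ∀ a, (B a).card ≤ d)
    (S G : Finset α) (hG : ∀ a ∈ G, ∀ b ∈ G, a ≠ b → R a b) (m : ℕ)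
    (hm : d * (G.card + m) ≤ S.card) :
    ∃ F : Finset α, G ⊆ F ∧ F ⊆ G ∪ S ∧ F.card = G.card + m ∧ m ≤ (F ∩ S).card ∧
      ∀ a ∈ F, ∀ b ∈ F, a ≠ b → R a b := by
  induction m with
  | zero => exact ⟨G, subset_rfl, Finset.subset_union_left, by simp, by simp, hG⟩
  | succ m ih =>
    obtain ⟨F, hGF, hFS, hF, hFm, hFR⟩ := ih (le_trans (by gcongr; omega) hm)
    have hlt : (F.biUnion B).card < S.card := by
      have h1 : (F.biUnion B).card ≤ F.card * d :=
        Finset.card_biUnion_le_card_mul _ _ _ fun a _ => hBd a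
      rw [hF] at h1
      nlinarith
    obtain ⟨q, hqS, hq⟩ := Finset.exists_mem_notMem_of_card_lt_card hlt
    have hq' : ∀ a ∈ F, R a q := fun a ha =>
      by_contra fun h => hq (Finset.mem_biUnion.2 ⟨a, ha, hB.2 h⟩)
    have hqF : q ∉ F := fun h => hirr q (hq' q h)
    refine ⟨insert q F, hGF.trans (Finset.subset_insert _ _), ?_, ?_, ?_, ?_⟩
    · exact Finset.insert_subset (Finset.mem_union_right _ hqS) hFS
    · rw [Finset.card_insert_of_notMem hqF, hF, add_assoc]
    · rw [Finset.insert_inter_of_mem hqS, Finset.card_insert_of_notMem (by simp [hqF])]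
      omega
    · intro a ha b hb hab
      rcases Finset.mem_insert.1 ha with ha | ha <;> rcases Finset.mem_insert.1 hb with hb | hb
      · exact absurd (ha.trans hb.symm) hab
      · exact ha ▸ hsymm _ _ (hq' b hb)
      · exact hb ▸ hq' a ha
      · exact hFR a ha b hb hab

theorem QuadDisjoint.symm {n : ℕ} {P Q : Fin n × Fin n × Fin n × Fin n}
    (h : QuadDisjoint P Q) : QuadDisjoint Q P := by
  obtain ⟨h1, h2, h3, h4, h5, h6, h7, h8⟩ := h
  exact ⟨h1.symm, h3.symm, h2.symm, h4.symm, h5.symm, h7.symm, h6.symm, h8.symm⟩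

/-- The 3-paths that share a vertex with `P`. -/
def meetingQuads {n : ℕ} (P : Fin n × Fin n × Fin n × Fin n) :
    Finset (Fin n × Fin n × Fin n × Fin n) :=
  ({P.1, P.2.2.1} ×ˢ Finset.univ ∪ Finset.univ ×ˢ Finset.univ ×ˢ {P.1, P.2.2.1} ×ˢ Finset.univ) ∪
    (Finset.univ ×ˢ {P.2.1, P.2.2.2} ×ˢ Finset.univ ∪
      Finset.univ ×ˢ Finset.univ ×ˢ Finset.univ ×ˢ {P.2.1, P.2.2.2})

theorem mem_meetingQuads {n : ℕ} {P Q : Fin n × Fin n × Fin n × Fin n} :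
    Q ∈ meetingQuads P ↔ ¬ QuadDisjoint P Q := by
  simp only [meetingQuads, QuadDisjoint, Finset.mem_union, Finset.mem_product, Finset.mem_insert,
    Finset.mem_singleton, Finset.mem_univ]
  grind

theorem card_meetingQuads_le {n : ℕ} (P : Fin n × Fin n × Fin n × Fin n) :
    (meetingQuads P).card ≤ 8 * n ^ 3 := by
  have hpair (a b : Fin n) : ({a, b} : Finset (Fin n)).card ≤ 2 := Finset.card_le_two
  have hX := Nat.mul_le_mul_right (n ^ 3) (hpair P.1 P.2.2.1)
  have hY := Nat.mul_le_mul_right (n ^ 3) (hpair P.2.1 P.2.2.2)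
  refine (Finset.card_union_le _ _).trans
    ((Nat.add_le_add (Finset.card_union_le _ _) (Finset.card_union_le _ _)).trans ?_)
  simp only [Finset.card_product, Finset.card_univ, Fintype.card_prod, Fintype.card_fin]
  linarith

/-- Two sets of at least `16 n³ m` quadruples each contain `m` members of a common
vertex-disjoint family of size `2 m`. -/
theorem exists_disjoint_family_of_card_le {n m : ℕ} (hn : 0 < n)
    (S T : Finset (Fin n × Fin n × Fin n × Fin n))
    (hS : 16 * n ^ 3 * m ≤ S.card) (hT : 16 * n ^ 3 * m ≤ T.card) :
    ∃ F ⊆ S ∪ T, F.card = 2 * m ∧ m ≤ (F ∩ S).card ∧ m ≤ (F ∩ T).card ∧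
      ∀ P ∈ F, ∀ Q ∈ F, P ≠ Q → QuadDisjoint P Q := by
  have extend := exists_pairwise_superset_of_card_le (R := QuadDisjoint (n := n))
    (B := meetingQuads) (d := 8 * n ^ 3) (fun _ _ h => h.symm) (fun _ h => h.1 rfl)
    (by positivity) mem_meetingQuads card_meetingQuads_le
  obtain ⟨G, -, hGS, hGm, hGSm, hG⟩ := extend S ∅ (by simp) m (by
    rw [Finset.card_empty]; nlinarith [Nat.zero_le (n ^ 3 * m)])
  rw [Finset.card_empty, zero_add] at hGm
  rw [Finset.empty_union] at hGS
  obtain ⟨F, hGF, hFT, hFm, hFTm, hF⟩ := extend T G hG m (by rw [hGm]; linarith)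
  exact ⟨F, hFT.trans (Finset.union_subset_union_left hGS), by omega,
    hGSm.trans (Finset.card_le_card (Finset.inter_subset_inter_right hGF)), hFTm, hF⟩

/-- Lemma 3.7.  Let `0 < γ < 1/2`.  There is `n₀(γ)` such that for all
`n ≥ n₀`, if `|𝒫(x,y)| ≥ γn⁴` and `|𝒫(x₁,y₁;x₂,y₂)| ≥ γn⁴`, then there is a family `ℱ`
of pairwise vertex-disjoint PC 3-paths with `|ℱ| ≤ 2⁻⁴γn`, `|ℱ ∩ 𝒫(x,y)| ≥ 2⁻⁷γ²n` and
`|ℱ ∩ 𝒫(x₁,y₁;x₂,y₂)| ≥ 2⁻⁷γ²n`. -/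
theorem absorbing_family_exists (γ : ℝ) (hγ0 : 0 < γ) (hγ : γ < 1 / 2) :
    ∃ n₀ : ℕ, ∀ n : ℕ, n₀ ≤ n → ∀ c : V2 n → V2 n → ℕ, (∀ u v, c u v = c v u) →
      ∀ x y x₁ x₂ y₁ y₂ : Fin n, x₁ ≠ x₂ → y₁ ≠ y₂ →
      γ * (n : ℝ) ^ 4 ≤
        (({P : Fin n × Fin n × Fin n × Fin n | IsAbsorbingPath1 n c x y P}).ncard : ℝ) →
      γ * (n : ℝ) ^ 4 ≤
        (({P : Fin n × Fin n × Fin n × Fin n |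
          IsAbsorbingPath2 n c x₁ y₁ x₂ y₂ P}).ncard : ℝ) →
      ∃ F : Finset (Fin n × Fin n × Fin n × Fin n),
        (∀ P ∈ F, IsPC3Path n c P) ∧
        (∀ P ∈ F, ∀ Q ∈ F, P ≠ Q → QuadDisjoint P Q) ∧
        (F.card : ℝ) ≤ γ * n / 2 ^ 4 ∧
        γ ^ 2 * n / 2 ^ 7 ≤
          ((((F : Set (Fin n × Fin n × Fin n × Fin n)) ∩
            {P | IsAbsorbingPath1 n c x y P}).ncard : ℝ)) ∧
        γ ^ 2 * n / 2 ^ 7 ≤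
          ((((F : Set (Fin n × Fin n × Fin n × Fin n)) ∩
            {P | IsAbsorbingPath2 n c x₁ y₁ x₂ y₂ P}).ncard : ℝ)) := by
  classical
  refine ⟨⌈64 / γ⌉₊, fun n hn c _ x y x₁ x₂ y₁ y₂ _ _ hP₁ hP₂ => ?_⟩
  have hγn : 64 ≤ γ * n := by
    have := (Nat.le_ceil (64 / γ)).trans (Nat.cast_le.2 hn)
    rwa [div_le_iff₀' hγ0] at this
  have hn0 : 0 < n := Nat.pos_of_ne_zero fun h => by norm_num [h] at hγn
  have hγγ : γ ^ 2 * n ≤ γ * n / 2 := by nlinarith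
  obtain ⟨m, hm, hm'⟩ : ∃ m : ℕ, γ ^ 2 * n / 2 ^ 7 ≤ m ∧ (m : ℝ) ≤ γ ^ 2 * n / 2 ^ 7 + 1 :=
    ⟨_, Nat.le_ceil _, (Nat.ceil_lt_add_one (by positivity)).le⟩
  have hmn : 16 * (n : ℝ) ^ 3 * m ≤ γ * n ^ 4 := by
    have h : 16 * (m : ℝ) ≤ γ * n := by linarith
    calc 16 * (n : ℝ) ^ 3 * m = n ^ 3 * (16 * m) := by ring
      _ ≤ n ^ 3 * (γ * n) := by gcongr
      _ = γ * n ^ 4 := by ring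
  have hcard (p : Fin n × Fin n × Fin n × Fin n → Prop)
      (h : γ * (n : ℝ) ^ 4 ≤ ({P | p P}.ncard : ℝ)) :
      16 * n ^ 3 * m ≤ (Finset.univ.filter p).card := by
    rw [← Finset.coe_filter_univ, Set.ncard_coe_finset] at h
    exact_mod_cast hmn.trans h
  obtain ⟨F, hFsub, hFm, hF₁, hF₂, hF⟩ :=
    exists_disjoint_family_of_card_le hn0 _ _ (hcard _ hP₁) (hcard _ hP₂)
  have hinter (p : Fin n × Fin n × Fin n × Fin n → Prop)
      (h : m ≤ (F ∩ Finset.univ.filter p).card) :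
      γ ^ 2 * n / 2 ^ 7 ≤ (((F : Set _) ∩ {P | p P}).ncard : ℝ) := by
    rw [← Finset.coe_filter_univ, ← Finset.coe_inter, Set.ncard_coe_finset]
    exact hm.trans (Nat.cast_le.2 h)
  refine ⟨F, fun P hP => ?_, hF, ?_, hinter _ hF₁, hinter _ hF₂⟩
  · rcases Finset.mem_union.1 (hFsub hP) with h | h
    · exact (Finset.mem_filter.1 h).2.1
    · exact (Finset.mem_filter.1 h).2.1
  · rw [hFm]
    push_cast
    linarith
end

section
/- Let K^c_{n,n} be an edge-colored complete balanced bipartite graph with parts X and Y satisfying δ^c(K^c_{n,n}) ≥ 2n/3 + 2. Then for every four distinct vertices x_1, x_2 ∈ X and y_1, y_2 ∈ Y, there exist at least 4n/3 edges xy with x ∈ X \ {x_1, x_2} and y ∈ Y \ {y_1, y_2} such that the 6-vertex path x_1 y_1 x y x_2 y_2 is properly colored. -/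
open SimpleGraph

/-- A color class and the set of all colors of a finite coloring compete for space. -/
theorem card_fiber_add_card_image_le {α β : Type*} [Fintype α] [DecidableEq β]
    (f : α → β) (a : α) :
    (Finset.univ.filter fun j => f j = f a).card + (Finset.univ.image f).card
      ≤ Fintype.card α + 1 := by
  classical
  have hsub : Finset.univ.image f ⊆
      insert (f a) ((Finset.univ.filter fun j => ¬ f j = f a).image f) := by
    intro k hk
    obtain ⟨j, -, rfl⟩ := Finset.mem_image.1 hk
    by_cases h : f j = f a
    · simp [h]
    · exact Finset.mem_insert_of_mem (Finset.mem_image_of_mem f (by simp [h]))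
  have h₁ := Finset.card_le_card hsub
  have h₂ := Finset.card_insert_le (f a) ((Finset.univ.filter fun j => ¬ f j = f a).image f)
  have h₃ := Finset.card_image_le (s := Finset.univ.filter fun j => ¬ f j = f a) (f := f)
  have h₄ := Finset.card_filter_add_card_filter_not (s := (Finset.univ : Finset α))
    (fun j => f j = f a)
  rw [Finset.card_univ] at h₄
  omega

/-- The elements other than `b` whose color differs from that of `a` are numerous. -/
theorem card_image_le_card_ne_fiber_add_two {α β : Type*} [Fintype α] [DecidableEq α]
    [DecidableEq β] (f : α → β) (a b : α) :
    (Finset.univ.image f).card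
      ≤ (Finset.univ.filter fun j => j ≠ b ∧ f j ≠ f a).card + 2 := by
  have h₁ := card_fiber_add_card_image_le f a
  have h₂ := Finset.card_filter_add_card_filter_not (s := (Finset.univ : Finset α))
    (fun j => f j = f a)
  rw [Finset.card_univ] at h₂
  have h₃ : (Finset.univ.filter fun j => ¬ f j = f a) ⊆
      insert b (Finset.univ.filter fun j => j ≠ b ∧ f j ≠ f a) := by
    intro j hj
    by_cases h : j = b <;> simp_all
  have h₄ := Finset.card_le_card h₃
  have h₅ := Finset.card_insert_le b (Finset.univ.filter fun j => j ≠ b ∧ f j ≠ f a)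
  omega

/-- Few elements other than `a` of a set share the color of `a`. -/
theorem card_fiber_ne_add_card_image_le {α β : Type*} [Fintype α] [DecidableEq β]
    (f : α → β) (a : α) (S : Finset α) (ha : a ∉ S) :
    (S.filter fun j => f j = f a).card + (Finset.univ.image f).card ≤ Fintype.card α := by
  classical
  have h₁ := card_fiber_add_card_image_le f a
  have hsub : insert a (S.filter fun j => f j = f a) ⊆
      Finset.univ.filter fun j => f j = f a := by
    intro j hj
    rcases Finset.mem_insert.1 hj with rfl | hj
    · simp
    · simpa using (Finset.mem_filter.1 hj).2
  have h₂ := Finset.card_le_card hsub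
  rw [Finset.card_insert_of_notMem (by simp [ha])] at h₂
  omega

/-- Pairs avoiding two relations, each of bounded degree on one of the two sides. -/
theorem card_mul_card_le_card_avoiding {α β : Type*} (A : Finset α) (B : Finset β)
    (r s : α → β → Prop) [∀ a b, Decidable (r a b)] [∀ a b, Decidable (s a b)] (q : ℕ)
    (hr : ∀ a ∈ A, (B.filter fun b => r a b).card ≤ q)
    (hs : ∀ b ∈ B, (A.filter fun a => s a b).card ≤ q) :
    A.card * B.card
      ≤ ((A ×ˢ B).filter fun p => ¬ r p.1 p.2 ∧ ¬ s p.1 p.2).card + A.card * q + B.card * q := by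
  classical
  have h₁ : ((A ×ˢ B).filter fun p => r p.1 p.2).card ≤ A.card * q := by
    rw [Finset.card_filter, Finset.sum_product, ← smul_eq_mul]
    refine Finset.sum_le_card_nsmul _ _ _ fun a ha => ?_
    rw [← Finset.card_filter]
    exact hr a ha
  have h₂ : ((A ×ˢ B).filter fun p => s p.1 p.2).card ≤ B.card * q := by
    rw [Finset.card_filter, Finset.sum_product_right, ← smul_eq_mul]
    refine Finset.sum_le_card_nsmul _ _ _ fun b hb => ?_
    rw [← Finset.card_filter]
    exact hs b hb
  have h₃ : A ×ˢ B ⊆ ((A ×ˢ B).filter fun p => ¬ r p.1 p.2 ∧ ¬ s p.1 p.2) ∪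
      (((A ×ˢ B).filter fun p => r p.1 p.2) ∪ ((A ×ˢ B).filter fun p => s p.1 p.2)) := by
    intro p hp
    simp only [Finset.mem_union, Finset.mem_filter, hp, true_and]
    tauto
  have h₄ := Finset.card_le_card h₃
  rw [Finset.card_product] at h₄
  have h₅ := Finset.card_union_le ((A ×ˢ B).filter fun p => ¬ r p.1 p.2 ∧ ¬ s p.1 p.2)
    (((A ×ˢ B).filter fun p => r p.1 p.2) ∪ ((A ×ˢ B).filter fun p => s p.1 p.2))
  have h₆ := Finset.card_union_le ((A ×ˢ B).filter fun p => r p.1 p.2)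
    ((A ×ˢ B).filter fun p => s p.1 p.2)
  omega

/-- Lemma 3.8.  If `δ^c(K_{n,n}) ≥ 2n/3 + 2`, then for all distinct
`x₁, x₂ ∈ X` and distinct `y₁, y₂ ∈ Y` there are at least `4n/3` edges `xy` with
`x ∈ X \ {x₁, x₂}`, `y ∈ Y \ {y₁, y₂}` such that `x₁y₁xyx₂y₂` is a PC path. -/
theorem many_connecting_edges (n : ℕ)
    (c : V2 n → V2 n → ℕ) (hsym : ∀ u v, c u v = c v u)
    (hdeg : ∀ v, (2 * n : ℝ) / 3 + 2 ≤ (colorDeg n c v : ℝ))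
    (x₁ x₂ y₁ y₂ : Fin n) (hx : x₁ ≠ x₂) (hy : y₁ ≠ y₂) :
    (4 : ℝ) * n / 3 ≤
      (({p : Fin n × Fin n |
        p.1 ≠ x₁ ∧ p.1 ≠ x₂ ∧ p.2 ≠ y₁ ∧ p.2 ≠ y₂ ∧
        c (Sum.inl x₁) (Sum.inr y₁) ≠ c (Sum.inr y₁) (Sum.inl p.1) ∧
        c (Sum.inr y₁) (Sum.inl p.1) ≠ c (Sum.inl p.1) (Sum.inr p.2) ∧
        c (Sum.inl p.1) (Sum.inr p.2) ≠ c (Sum.inr p.2) (Sum.inl x₂) ∧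
        c (Sum.inr p.2) (Sum.inl x₂) ≠ c (Sum.inl x₂) (Sum.inr y₂)}).ncard : ℝ) := by
  classical
  set A : Finset (Fin n) := Finset.univ.filter fun x =>
    x ≠ x₂ ∧ c (Sum.inr y₁) (Sum.inl x) ≠ c (Sum.inr y₁) (Sum.inl x₁) with hA
  set B : Finset (Fin n) := Finset.univ.filter fun y =>
    y ≠ y₁ ∧ c (Sum.inl x₂) (Sum.inr y) ≠ c (Sum.inl x₂) (Sum.inr y₂) with hB
  have hy₁B : y₁ ∉ B := by simp [hB]
  have hx₂A : x₂ ∉ A := by simp [hA]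
  have hdeg' (v : V2 n) : 2 * n + 6 ≤ 3 * colorDeg n c v := by
    have h : (2 * n + 6 : ℝ) ≤ 3 * colorDeg n c v := by linarith [hdeg v]
    exact_mod_cast h
  have hAcard : 2 * n ≤ 3 * A.card := by
    have h₁ := card_image_le_card_ne_fiber_add_two
      (fun x => c (Sum.inr y₁) (Sum.inl x)) x₁ x₂
    have h₂ : 2 * n + 6 ≤ 3 * (Finset.univ.image fun x => c (Sum.inr y₁) (Sum.inl x)).card :=
      hdeg' (Sum.inr y₁)
    simp only [← hA] at h₁
    omega
  have hBcard : 2 * n ≤ 3 * B.card := by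
    have h₁ := card_image_le_card_ne_fiber_add_two
      (fun y => c (Sum.inl x₂) (Sum.inr y)) y₂ y₁
    have h₂ : 2 * n + 6 ≤ 3 * (Finset.univ.image fun y => c (Sum.inl x₂) (Sum.inr y)).card :=
      hdeg' (Sum.inl x₂)
    simp only [← hB] at h₁
    omega
  have hcount := card_mul_card_le_card_avoiding A B
    (fun x y => c (Sum.inl x) (Sum.inr y) = c (Sum.inl x) (Sum.inr y₁))
    (fun x y => c (Sum.inr y) (Sum.inl x) = c (Sum.inr y) (Sum.inl x₂)) ((n - 6) / 3)
    (fun x _ => by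
      have h₁ := card_fiber_ne_add_card_image_le
        (fun y => c (Sum.inl x) (Sum.inr y)) y₁ B hy₁B
      have h₂ : 2 * n + 6 ≤ 3 * (Finset.univ.image fun y => c (Sum.inl x) (Sum.inr y)).card :=
        hdeg' (Sum.inl x)
      rw [Fintype.card_fin] at h₁
      omega)
    (fun y _ => by
      have h₁ := card_fiber_ne_add_card_image_le
        (fun x => c (Sum.inr y) (Sum.inl x)) x₂ A hx₂A
      have h₂ : 2 * n + 6 ≤ 3 * (Finset.univ.image fun x => c (Sum.inr y) (Sum.inl x)).card :=
        hdeg' (Sum.inr y)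
      rw [Fintype.card_fin] at h₁
      omega)
  have hn : 6 ≤ n := by
    have h₁ : (Finset.univ.image fun y => c (Sum.inl x₂) (Sum.inr y)).card ≤ n := by
      simpa using Finset.card_image_le (s := (Finset.univ : Finset (Fin n)))
        (f := fun y => c (Sum.inl x₂) (Sum.inr y))
    have h₂ : 2 * n + 6 ≤ 3 * (Finset.univ.image fun y => c (Sum.inl x₂) (Sum.inr y)).card :=
      hdeg' (Sum.inl x₂)
    omega
  have hq : 3 * ((n - 6) / 3) + 6 ≤ n := by omega
  generalize (n - 6) / 3 = q at hcount hq
  set G := (A ×ˢ B).filter fun p =>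
    ¬ c (Sum.inl p.1) (Sum.inr p.2) = c (Sum.inl p.1) (Sum.inr y₁) ∧
    ¬ c (Sum.inr p.2) (Sum.inl p.1) = c (Sum.inr p.2) (Sum.inl x₂) with hG
  have hGle : (4 : ℝ) * n / 3 ≤ G.card := by
    have hcount' : (A.card * B.card : ℝ) ≤ G.card + A.card * q + B.card * q := by
      exact_mod_cast hcount
    have hA' : (2 * n : ℝ) ≤ 3 * A.card := by exact_mod_cast hAcard
    have hB' : (2 * n : ℝ) ≤ 3 * B.card := by exact_mod_cast hBcard
    have hq' : (3 * q + 6 : ℝ) ≤ n := by exact_mod_cast hq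
    have hq₀ : (0 : ℝ) ≤ q := q.cast_nonneg
    have h : ((n : ℝ) / 3 + 2) * (n / 3 + 2) ≤ (A.card - q) * (B.card - q) :=
      mul_le_mul (by linarith) (by linarith) (by positivity) (by linarith)
    have h' : (q : ℝ) * q ≤ (n / 3 - 2) * (n / 3 - 2) :=
      mul_le_mul (by linarith) (by linarith) hq₀ (by linarith)
    nlinarith
  refine hGle.trans ?_
  rw [← Set.ncard_coe_finset G]
  refine Nat.cast_le.2 (Set.ncard_le_ncard ?_ (Set.toFinite _))
  rintro ⟨x, y⟩ hp
  simp only [hG, hA, hB, Finset.coe_filter, Finset.mem_product, Finset.mem_filter,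
    Finset.mem_univ, true_and, Set.mem_ofPred_eq] at hp ⊢
  obtain ⟨⟨⟨hxx₂, hcx⟩, hyy₁, hcy⟩, hc₁, hc₂⟩ := hp
  refine ⟨?_, hxx₂, hyy₁, ?_, ?_, ?_, ?_, ?_⟩
  · rintro rfl
    exact hcx rfl
  · rintro rfl
    exact hcy rfl
  · rw [hsym (Sum.inl x₁)]
    exact hcx.symm
  · rw [hsym (Sum.inr y₁)]
    exact Ne.symm hc₁
  · rw [hsym (Sum.inl x)]
    exact hc₂
  · rw [hsym (Sum.inr y)]
    exact hcy
end

section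
/- Let ε > 0. There exists an integer n_0(ε) such that for every n ≥ n_0(ε) and every edge-colored complete balanced bipartite graph G = K^c_{n,n} with δ^c(G) ≥ (2/3 + ε)n, there exists a properly colored cycle C in G of length at most (2/3)ε² n with the following absorbing property: for every positive integer k ≤ 2ε⁴ n / 81 and every k pairwise vertex-disjoint properly colored odd paths Q_1, …, Q_k in G \ V(C), there exists a properly colored cycle C' with V(C') = V(C) ∪ ⋃_{1 ≤ i ≤ k} V(Q_i). -/
open SimpleGraph

/-- `Link C p q`: for edges `p = xy` and `q = x'y'`, the path `x y x' y'` is properly colored. -/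
def Link {n : ℕ} (C : Fin n → Fin n → ℕ) (p q : Fin n × Fin n) : Prop :=
  C p.1 p.2 ≠ C q.1 p.2 ∧ C q.1 p.2 ≠ C q.1 q.2

/-- The two endpoints of an edge of `K_{n,n}`. -/
def pairVerts {n : ℕ} (p : Fin n × Fin n) : List (V2 n) := [Sum.inl p.1, Sum.inr p.2]

/-- The four vertices of a pair of edges. -/
def quadVerts {n : ℕ} (t : (Fin n × Fin n) × (Fin n × Fin n)) : List (V2 n) :=
  pairVerts t.1 ++ pairVerts t.2

/-- The 3-path `t` can absorb any path with first edge `q.1` and last edge `q.2`. -/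
def AbsorbsPair {n : ℕ} (C : Fin n → Fin n → ℕ) (q t : (Fin n × Fin n) × (Fin n × Fin n)) : Prop :=
  Link C t.1 q.1 ∧ Link C q.2 t.2

/-- Every vertex sees at least `D` colors, in a form convenient for discarding some colors. -/
structure ColorRich {n : ℕ} (C : Fin n → Fin n → ℕ) (D : ℕ) : Prop where
  left : ∀ (x : Fin n) (S : Finset ℕ), D ≤ S.card + (Finset.univ.filter fun y => C x y ∉ S).card
  right : ∀ (y : Fin n) (S : Finset ℕ), D ≤ S.card + (Finset.univ.filter fun x => C x y ∉ S).card

lemma card_image_le_card_add_filter {n : ℕ} (g : Fin n → ℕ) (S : Finset ℕ) :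
    (Finset.univ.image g).card ≤ S.card + (Finset.univ.filter fun y => g y ∉ S).card := by
  have h : Finset.univ.image g ⊆ S ∪ (Finset.univ.filter fun y => g y ∉ S).image g := by
    intro z hz
    simp only [Finset.mem_image, Finset.mem_univ, true_and, Finset.mem_union,
      Finset.mem_filter] at hz ⊢
    obtain ⟨y, rfl⟩ := hz
    by_cases hy : g y ∈ S
    · exact Or.inl hy
    · exact Or.inr ⟨y, hy, rfl⟩
  calc _ ≤ _ := Finset.card_le_card h
    _ ≤ _ := Finset.card_union_le _ _
    _ ≤ _ := Nat.add_le_add_left Finset.card_image_le _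

lemma card_filter_le_card_add {α β : Type*} [Fintype α] [DecidableEq β] (p : α → Prop)
    [DecidablePred p] (i : α → β) (hi : Function.Injective i) (F : Finset β) :
    (Finset.univ.filter p).card ≤ F.card + (Finset.univ.filter fun y => p y ∧ i y ∉ F).card := by
  classical
  rw [← Finset.card_filter_add_card_filter_not (s := Finset.univ.filter p) (fun y => i y ∈ F),
    Finset.filter_filter, Finset.filter_filter]
  refine Nat.add_le_add_right (Finset.card_le_card_of_injOn i ?_ hi.injOn) _
  intro y hy
  simp only [Finset.coe_filter, Finset.mem_univ, true_and, Set.mem_ofPred_eq] at hy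
  exact hy.2

lemma ColorRich.left_avoid {n : ℕ} {C : Fin n → Fin n → ℕ} {D : ℕ} (h : ColorRich C D)
    (x : Fin n) (S : Finset ℕ) (F : Finset (V2 n)) :
    D ≤ S.card + F.card + (Finset.univ.filter fun y => C x y ∉ S ∧ Sum.inr y ∉ F).card := by
  have h1 := h.left x S
  have h2 := card_filter_le_card_add (fun y => C x y ∉ S) Sum.inr Sum.inr_injective F
  omega

lemma ColorRich.right_avoid {n : ℕ} {C : Fin n → Fin n → ℕ} {D : ℕ} (h : ColorRich C D)
    (y : Fin n) (S : Finset ℕ) (F : Finset (V2 n)) :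
    D ≤ S.card + F.card + (Finset.univ.filter fun x => C x y ∉ S ∧ Sum.inl x ∉ F).card := by
  have h1 := h.right y S
  have h2 := card_filter_le_card_add (fun x => C x y ∉ S) Sum.inl Sum.inl_injective F
  omega

lemma ColorRich.left_mono {n : ℕ} {C : Fin n → Fin n → ℕ} {D : ℕ} (h : ColorRich C D)
    (x : Fin n) (γ : ℕ) : D + (Finset.univ.filter fun y => C x y = γ).card ≤ n + 1 := by
  have h1 := h.left x {γ}
  have h2 := Finset.card_filter_add_card_filter_not (s := (Finset.univ : Finset (Fin n)))
    (fun y => C x y = γ)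
  simp only [Finset.mem_singleton, Finset.card_singleton, Finset.card_univ, Fintype.card_fin]
    at h1 h2
  omega

lemma ColorRich.right_mono {n : ℕ} {C : Fin n → Fin n → ℕ} {D : ℕ} (h : ColorRich C D)
    (y : Fin n) (γ : ℕ) : D + (Finset.univ.filter fun x => C x y = γ).card ≤ n + 1 := by
  have h1 := h.right y {γ}
  have h2 := Finset.card_filter_add_card_filter_not (s := (Finset.univ : Finset (Fin n)))
    (fun x => C x y = γ)
  simp only [Finset.mem_singleton, Finset.card_singleton, Finset.card_univ, Fintype.card_fin]
    at h1 h2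
  omega

/-- Any two edges can be joined through a new edge avoiding a small set of vertices. -/
lemma ColorRich.exists_link {n : ℕ} {C : Fin n → Fin n → ℕ} {D : ℕ} (h : ColorRich C D)
    (F : Finset (V2 n)) (hF : 2 * n + 3 + F.card < 3 * D) (p q : Fin n × Fin n) :
    ∃ k : Fin n × Fin n, Link C p k ∧ Link C k q ∧ ∀ v ∈ pairVerts k, v ∉ F := by
  set A := Finset.univ.filter fun x => C x p.2 ∉ ({C p.1 p.2} : Finset ℕ) ∧ Sum.inl x ∉ F with hA
  set B := Finset.univ.filter fun y => C q.1 y ∉ ({C q.1 q.2} : Finset ℕ) ∧ Sum.inr y ∉ F with hB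
  have h1 := h.right_avoid p.2 {C p.1 p.2} F
  have h2 := h.left_avoid q.1 {C q.1 q.2} F
  rw [← hA] at h1
  rw [← hB] at h2
  rw [Finset.card_singleton] at h1 h2
  by_contra hcon
  have hbad : ∀ x ∈ A, ∀ y ∈ B, C x y = C x p.2 ∨ C x y = C q.1 y := by
    intro x hx y hy
    by_contra hxy
    simp only [hA, hB, Finset.mem_filter, Finset.mem_univ, true_and, Finset.mem_singleton]
      at hx hy
    push Not at hxy
    refine hcon ⟨(x, y), ⟨fun e => hx.1 e.symm, fun e => hxy.1 e.symm⟩, ⟨hxy.2, hy.1⟩, ?_⟩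
    simp only [pairVerts, List.mem_cons, List.not_mem_nil, or_false]
    rintro v (rfl | rfl)
    exacts [hx.2, hy.2]
  have hsub : A ×ˢ B ⊆ (A.sigma fun x => Finset.univ.filter fun y => C x y = C x p.2).map
        ⟨fun s => (s.1, s.2), by rintro ⟨a, b⟩ ⟨c, d⟩ e; simpa using e⟩ ∪
      (B.sigma fun y => Finset.univ.filter fun x => C x y = C q.1 y).map
        ⟨fun s => (s.2, s.1), by rintro ⟨a, b⟩ ⟨c, d⟩ e; simpa [and_comm] using e⟩ := by
    rintro ⟨x, y⟩ hxy
    rw [Finset.mem_product] at hxy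
    rw [Finset.mem_union, Finset.mem_map, Finset.mem_map]
    rcases hbad x hxy.1 y hxy.2 with e | e
    · exact Or.inl ⟨⟨x, y⟩, by simpa using ⟨hxy.1, e⟩, rfl⟩
    · exact Or.inr ⟨⟨y, x⟩, by simpa using ⟨hxy.2, e⟩, rfl⟩
  have hcard := (Finset.card_le_card hsub).trans (Finset.card_union_le _ _)
  rw [Finset.card_map, Finset.card_map, Finset.card_product, Finset.card_sigma,
    Finset.card_sigma] at hcard
  have s1 : ∑ x ∈ A, (Finset.univ.filter fun y => C x y = C x p.2).card ≤ A.card * (n + 1 - D) := by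
    rw [← smul_eq_mul]
    refine Finset.sum_le_card_nsmul _ _ _ fun x _ => ?_
    have := h.left_mono x (C x p.2)
    omega
  have s2 : ∑ y ∈ B, (Finset.univ.filter fun x => C x y = C q.1 y).card ≤ B.card * (n + 1 - D) := by
    rw [← smul_eq_mul]
    refine Finset.sum_le_card_nsmul _ _ _ fun y _ => ?_
    have := h.right_mono y (C q.1 y)
    omega
  have hD : D ≤ n + 1 := le_trans (Nat.le_add_right _ _) (h.left_mono p.1 0)
  obtain ⟨m, hm⟩ : ∃ m, m = n + 1 - D := ⟨_, rfl⟩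
  rw [← hm] at s1 s2
  have a1 : 2 * m < A.card := by omega
  have a2 : 2 * m < B.card := by omega
  nlinarith

open Classical in
/-- The properly colored 3-paths avoiding `F`. -/
noncomputable def freshQuads {n : ℕ} (C : Fin n → Fin n → ℕ) (F : Finset (V2 n)) :
    Finset ((Fin n × Fin n) × (Fin n × Fin n)) :=
  Finset.univ.filter fun t =>
    Link C t.1 t.2 ∧ (quadVerts t).Nodup ∧ ∀ v ∈ quadVerts t, v ∉ F

open Classical in
/-- A positive proportion of all 3-paths are fresh and absorb a given pair of edges. -/
lemma ColorRich.card_absorbers {n : ℕ} {C : Fin n → Fin n → ℕ} {D : ℕ} (h : ColorRich C D)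
    (F : Finset (V2 n)) (hF : n + 2 * (3 + F.card) ≤ 2 * D)
    (q : (Fin n × Fin n) × (Fin n × Fin n)) :
    n ^ 4 ≤ 16 * ((freshQuads C F).filter (AbsorbsPair C q)).card := by
  set B := Finset.univ.filter fun b =>
    C q.1.1 b ∉ ({C q.1.1 q.1.2} : Finset ℕ) ∧ Sum.inr b ∉ F with hB
  set A := Finset.univ.filter fun a =>
    C a q.2.2 ∉ ({C q.2.1 q.2.2} : Finset ℕ) ∧ Sum.inl a ∉ F with hA
  let A' : Fin n × Fin n → Finset (Fin n) := fun s => Finset.univ.filter fun a =>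
    C a s.1 ∉ ({C s.2 s.1, C q.1.1 s.1} : Finset ℕ) ∧ Sum.inl a ∉ insert (Sum.inl s.2) F
  let B' : Fin n × Fin n → Finset (Fin n) := fun s => Finset.univ.filter fun b =>
    C s.2 b ∉ ({C s.2 s.1, C s.2 q.2.2} : Finset ℕ) ∧ Sum.inr b ∉ insert (Sum.inr s.1) F
  have cB : n ≤ 2 * B.card := by
    have := h.left_avoid q.1.1 {C q.1.1 q.1.2} F
    rw [← hB, Finset.card_singleton] at this
    omega
  have cA : n ≤ 2 * A.card := by
    have := h.right_avoid q.2.2 {C q.2.1 q.2.2} F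
    rw [← hA, Finset.card_singleton] at this
    omega
  have cA' : ∀ s, n ≤ 2 * (A' s).card := by
    intro s
    have h1 := h.right_avoid s.1 {C s.2 s.1, C q.1.1 s.1} (insert (Sum.inl s.2) F)
    have h2 := Finset.card_insert_le (Sum.inl s.2 : V2 n) F
    have h3 := Finset.card_le_two (a := C s.2 s.1) (b := C q.1.1 s.1)
    change D ≤ _ + _ + (A' s).card at h1
    omega
  have cB' : ∀ s, n ≤ 2 * (B' s).card := by
    intro s
    have h1 := h.left_avoid s.2 {C s.2 s.1, C s.2 q.2.2} (insert (Sum.inr s.1) F)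
    have h2 := Finset.card_insert_le (Sum.inr s.1 : V2 n) F
    have h3 := Finset.card_le_two (a := C s.2 s.1) (b := C s.2 q.2.2)
    change D ≤ _ + _ + (B' s).card at h1
    omega
  have hinj : ((B ×ˢ A).sigma fun s => A' s ×ˢ B' s).card ≤
      ((freshQuads C F).filter (AbsorbsPair C q)).card := by
    refine Finset.card_le_card_of_injOn (fun z => ((z.2.1, z.1.1), (z.1.2, z.2.2))) ?_ ?_
    · rintro ⟨⟨b, a'⟩, ⟨a, b'⟩⟩ hz
      simp only [Finset.coe_sigma, Finset.coe_product, Set.mem_sigma_iff, Set.mem_prod,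
        Finset.mem_coe, hA, hB, A', B', Finset.mem_filter, Finset.mem_univ, true_and,
        Finset.mem_insert, Finset.mem_singleton, not_or, Sum.inl.injEq, Sum.inr.injEq] at hz
      obtain ⟨⟨⟨hb, hbF⟩, ha', ha'F⟩, ⟨⟨ha1, ha2⟩, haa', haF⟩, ⟨hb1, hb2⟩, hbb', hb'F⟩ := hz
      rw [Finset.mem_coe, Finset.mem_filter, freshQuads, Finset.mem_filter]
      simp only [AbsorbsPair, Link, quadVerts, pairVerts]
      refine ⟨⟨Finset.mem_univ _, ⟨ha1, fun e => hb1 e.symm⟩, ?_, ?_⟩, ⟨ha2, hb⟩,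
        fun e => ha' e.symm, fun e => hb2 e.symm⟩
      · simp [haa', Ne.symm hbb']
      · simp [haF, hbF, ha'F, hb'F]
    · rintro ⟨⟨b, a'⟩, ⟨a, b'⟩⟩ _ ⟨⟨d, c'⟩, ⟨e, d'⟩⟩ _ heq
      simp only [Prod.mk.injEq] at heq
      obtain ⟨⟨rfl, rfl⟩, rfl, rfl⟩ := heq
      rfl
  have hsum : n ^ 2 * (B.card * A.card) ≤
      4 * ((B ×ˢ A).sigma fun s => A' s ×ˢ B' s).card := by
    rw [Finset.card_sigma, ← Finset.card_product, Finset.mul_sum, mul_comm, ← smul_eq_mul]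
    refine Finset.card_nsmul_le_sum _ _ _ fun s _ => ?_
    rw [Finset.card_product]
    have := Nat.mul_le_mul (cA' s) (cB' s)
    nlinarith
  have hBA : n ^ 2 ≤ 4 * (B.card * A.card) := by
    have := Nat.mul_le_mul cB cA
    nlinarith
  calc n ^ 4 = n ^ 2 * n ^ 2 := by ring
    _ ≤ n ^ 2 * (4 * (B.card * A.card)) := Nat.mul_le_mul_left _ hBA
    _ = 4 * (n ^ 2 * (B.card * A.card)) := by ring
    _ ≤ 4 * (4 * ((B ×ˢ A).sigma fun s => A' s ×ˢ B' s).card) := Nat.mul_le_mul_left _ hsum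
    _ = 16 * ((B ×ˢ A).sigma fun s => A' s ×ˢ B' s).card := by ring
    _ ≤ _ := Nat.mul_le_mul_left _ hinj

open Classical in
/-- Derandomized selection: some `t` decreases the total weight by a constant factor. -/
lemma exists_weight_decrease {Q T : Type*} [Fintype Q] (U : Finset T) (hU : U.Nonempty)
    (A : Q → T → Prop) (hA : ∀ q, U.card ≤ 16 * (U.filter (A q)).card) (w : Q → ℝ)
    (hw : ∀ q, 0 ≤ w q) :
    ∃ t ∈ U, ∑ q, w q * (if A q t then 1 / 2 else 1) ≤ 31 / 32 * ∑ q, w q := by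
  refine Finset.exists_le_of_sum_le hU ?_
  rw [Finset.sum_comm, Finset.sum_const, nsmul_eq_mul, ← mul_assoc, Finset.mul_sum]
  refine Finset.sum_le_sum fun q _ => ?_
  rw [← Finset.mul_sum, mul_comm]
  refine mul_le_mul_of_nonneg_right ?_ (hw q)
  have h1 : ∀ t, (if A q t then (1 / 2 : ℝ) else 1) = 1 - 1 / 2 * (if A q t then 1 else 0) := by
    intro t
    split_ifs <;> norm_num
  simp_rw [h1]
  rw [Finset.sum_sub_distrib, ← Finset.mul_sum, Finset.sum_boole, Finset.sum_const, nsmul_eq_mul]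
  have h2 : (U.card : ℝ) ≤ 16 * ((U.filter (A q)).card : ℝ) := by exact_mod_cast hA q
  linarith

lemma length_flatMap_quadVerts {n : ℕ} (ts : List ((Fin n × Fin n) × (Fin n × Fin n))) :
    (ts.flatMap quadVerts).length = 4 * ts.length := by
  induction ts with
  | nil => rfl
  | cons t ts ih =>
    rw [List.flatMap_cons, List.length_append, ih]
    simp [quadVerts, pairVerts]
    ring

open Classical in
/-- Disjoint 3-paths such that every pair of edges is absorbed by many of them. -/
lemma ColorRich.exists_quads {n : ℕ} {C : Fin n → Fin n → ℕ} {D N : ℕ} (h : ColorRich C D)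
    (hn : 0 < n) (hN : n + 2 * (3 + 4 * N) ≤ 2 * D) (j : ℕ) (hj : j ≤ N) :
    ∃ ts : List ((Fin n × Fin n) × (Fin n × Fin n)), ts.length = j ∧
      (ts.flatMap quadVerts).Nodup ∧ (∀ t ∈ ts, Link C t.1 t.2) ∧
      ∑ q : (Fin n × Fin n) × (Fin n × Fin n),
        (1 / 2 : ℝ) ^ (ts.toFinset.filter (AbsorbsPair C q)).card ≤ (n : ℝ) ^ 4 * (31 / 32) ^ j := by
  induction j with
  | zero =>
    refine ⟨[], rfl, by simp, by simp, ?_⟩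
    simp
    apply le_of_eq
    ring
  | succ j ih =>
    obtain ⟨ts, hlen, hnd, hlink, hw⟩ := ih (by omega)
    set F := (ts.flatMap quadVerts).toFinset with hFdef
    have hF : F.card ≤ 4 * N := by
      refine (List.toFinset_card_le _).trans ?_
      rw [length_flatMap_quadVerts]
      omega
    have hab := h.card_absorbers F (by omega)
    have hcard : (freshQuads C F).card ≤ n ^ 4 := by
      refine (Finset.card_le_univ _).trans (le_of_eq ?_)
      simp
      ring
    let p : Fin n × Fin n := (⟨0, hn⟩, ⟨0, hn⟩)
    have hne : (freshQuads C F).Nonempty := by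
      have h1 := hab (p, p)
      have h2 : 0 < n ^ 4 := by positivity
      have h3 : 0 < ((freshQuads C F).filter (AbsorbsPair C (p, p))).card := by omega
      exact (Finset.card_pos.1 h3).mono (Finset.filter_subset _ _)
    obtain ⟨t, ht, htw⟩ := exists_weight_decrease (freshQuads C F) hne (AbsorbsPair C)
      (fun q => hcard.trans (hab q))
      (fun q => (1 / 2 : ℝ) ^ (ts.toFinset.filter (AbsorbsPair C q)).card) (fun q => by positivity)
    simp only [freshQuads, Finset.mem_filter, Finset.mem_univ, true_and] at ht
    obtain ⟨ht1, ht2, ht3⟩ := ht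
    have htn : t ∉ ts := fun hmem =>
      ht3 (Sum.inl t.1.1) (by simp [quadVerts, pairVerts])
        (List.mem_toFinset.2 (List.mem_flatMap.2 ⟨t, hmem, by simp [quadVerts, pairVerts]⟩))
    refine ⟨t :: ts, by simp [hlen], ?_, ?_, ?_⟩
    · rw [List.flatMap_cons]
      exact ht2.append hnd fun v hv hv' => ht3 v hv (List.mem_toFinset.2 hv')
    · intro s hs
      rcases List.mem_cons.1 hs with rfl | hs
      exacts [ht1, hlink s hs]
    · calc _ = ∑ q, (1 / 2 : ℝ) ^ (ts.toFinset.filter (AbsorbsPair C q)).card *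
            (if AbsorbsPair C q t then 1 / 2 else 1) := by
            refine Finset.sum_congr rfl fun q _ => ?_
            rw [List.toFinset_cons, Finset.filter_insert]
            split_ifs
            · rw [Finset.card_insert_of_notMem (by simp [htn]), pow_succ]
            · rw [mul_one]
        _ ≤ _ := htw
        _ ≤ 31 / 32 * ((n : ℝ) ^ 4 * (31 / 32) ^ j) := by gcongr
        _ = _ := by ring

/-- The vertices of a list of edges. -/
def edgeVerts {n : ℕ} (l : List (Fin n × Fin n)) : List (V2 n) := l.flatMap pairVerts

lemma length_edgeVerts {n : ℕ} (l : List (Fin n × Fin n)) :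
    (edgeVerts l).length = 2 * l.length := by
  induction l with
  | nil => rfl
  | cons p l ih =>
    rw [edgeVerts] at ih ⊢
    rw [List.flatMap_cons, List.length_append, ih]
    simp [pairVerts]
    ring

/-- The first and last edges of a 3-path, followed by a connecting edge. -/
def baseBlock {n : ℕ} (s : ((Fin n × Fin n) × (Fin n × Fin n)) × (Fin n × Fin n)) :
    List (Fin n × Fin n) := [s.1.1, s.1.2, s.2]

/-- A block with a further list of edges inserted into its 3-path. -/
def insertBlock {n : ℕ} (I : (Fin n × Fin n) × (Fin n × Fin n) → List (Fin n × Fin n))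
    (s : ((Fin n × Fin n) × (Fin n × Fin n)) × (Fin n × Fin n)) : List (Fin n × Fin n) :=
  s.1.1 :: (I s.1 ++ [s.1.2, s.2])

/-- Disjoint 3-paths can be connected into a properly colored path leading to a given edge. -/
lemma ColorRich.exists_connected {n : ℕ} {C : Fin n → Fin n → ℕ} {D : ℕ} (h : ColorRich C D)
    (ts : List ((Fin n × Fin n) × (Fin n × Fin n))) (e : Fin n × Fin n)
    (hlink : ∀ t ∈ ts, Link C t.1 t.2) (F : Finset (V2 n))
    (hF : 2 * n + 3 + (F.card + 2 * ts.length) < 3 * D) :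
    ∃ B : List (((Fin n × Fin n) × (Fin n × Fin n)) × (Fin n × Fin n)),
      B.map Prod.fst = ts ∧ (B.flatMap baseBlock ++ [e]).IsChain (Link C) ∧
      (edgeVerts (B.map Prod.snd)).Nodup ∧ ∀ v ∈ edgeVerts (B.map Prod.snd), v ∉ F := by
  induction ts with
  | nil => exact ⟨[], rfl, by simp, by simp [edgeVerts], by simp [edgeVerts]⟩
  | cons t ts ih =>
    rw [List.length_cons] at hF
    obtain ⟨B, hB, hch, hnd, hav⟩ := ih (fun s hs => hlink s (List.mem_cons_of_mem _ hs)) (by omega)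
    have hlen : (edgeVerts (B.map Prod.snd)).length = 2 * ts.length := by
      rw [← hB]
      rw [length_edgeVerts, List.length_map, List.length_map]
    obtain ⟨d, l, hdl⟩ : ∃ d l, B.flatMap baseBlock ++ [e] = d :: l :=
      List.exists_cons_of_ne_nil (by simp)
    obtain ⟨k, hk1, hk2, hk3⟩ := h.exists_link (F ∪ (edgeVerts (B.map Prod.snd)).toFinset)
      (by
        have h1 := Finset.card_union_le F (edgeVerts (B.map Prod.snd)).toFinset
        have h2 := List.toFinset_card_le (edgeVerts (B.map Prod.snd))
        omega) t.2 d
    refine ⟨(t, k) :: B, by simp [hB], ?_, ?_, ?_⟩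
    · rw [List.flatMap_cons, List.append_assoc, hdl]
      rw [hdl] at hch
      simp only [baseBlock, List.cons_append, List.nil_append, List.isChain_cons_cons]
      exact ⟨hlink t List.mem_cons_self, hk1, hk2, hch⟩
    · rw [List.map_cons, edgeVerts, List.flatMap_cons]
      refine List.Nodup.append (by simp [pairVerts]) hnd fun v hv hv' => hk3 v hv ?_
      exact Finset.mem_union_right _ (List.mem_toFinset.2 hv')
    · intro v hv
      rw [List.map_cons, edgeVerts, List.flatMap_cons, List.mem_append] at hv
      rcases hv with hv | hv
      · exact fun hvF => hk3 v hv (Finset.mem_union_left _ hvF)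
      · exact hav v hv

lemma isChain_flatMap_insertBlock {n : ℕ} {C : Fin n → Fin n → ℕ}
    (I : (Fin n × Fin n) × (Fin n × Fin n) → List (Fin n × Fin n)) (e : Fin n × Fin n)
    (B : List (((Fin n × Fin n) × (Fin n × Fin n)) × (Fin n × Fin n)))
    (hB : (B.flatMap baseBlock ++ [e]).IsChain (Link C))
    (hI : ∀ s ∈ B, (s.1.1 :: (I s.1 ++ [s.1.2])).IsChain (Link C)) :
    (B.flatMap (insertBlock I) ++ [e]).IsChain (Link C) := by
  induction B with
  | nil => simp
  | cons s B ih =>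
    have hhead : (B.flatMap (insertBlock I) ++ [e]).head? = (B.flatMap baseBlock ++ [e]).head? := by
      cases B <;> simp [insertBlock, baseBlock]
    rw [List.flatMap_cons, List.append_assoc] at hB ⊢
    simp only [baseBlock, List.cons_append, List.nil_append, List.isChain_cons_cons] at hB
    obtain ⟨-, h2, h3⟩ := hB
    rw [List.isChain_cons] at h3
    have ih' := ih h3.2 fun s hs => hI s (List.mem_cons_of_mem _ hs)
    have hs := hI s List.mem_cons_self
    have heq : insertBlock I s ++ (B.flatMap (insertBlock I) ++ [e]) =
        (s.1.1 :: I s.1) ++ s.1.2 :: s.2 :: (B.flatMap (insertBlock I) ++ [e]) := by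
      simp [insertBlock]
    rw [heq, List.isChain_split]
    refine ⟨by simpa using hs, ?_⟩
    rw [List.isChain_cons_cons, List.isChain_cons, hhead]
    exact ⟨h2, h3.1, ih'⟩

/-- A closed properly colored chain of disjoint edges is a properly colored cycle. -/
lemma exists_isPCCycle_of_chain {n : ℕ} {c : V2 n → V2 n → ℕ} (hc : ∀ u v, c u v = c v u)
    (l : List (Fin n × Fin n)) (hlen : 2 ≤ l.length) (e : Fin n × Fin n) (he : l.head? = some e)
    (hl : (l ++ [e]).IsChain (Link fun x y => c (Sum.inl x) (Sum.inr y)))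
    (hnd : (edgeVerts l).Nodup) :
    ∃ f : ZMod (2 * l.length) → V2 n, IsPCCycle n c (2 * l.length) f ∧
      Set.range f = {v | v ∈ edgeVerts l} := by
  set M := l.length with hM
  have hM0 : 0 < M := by omega
  have : NeZero (2 * M) := ⟨by omega⟩
  let P : ℕ → Fin n × Fin n := fun i => l[i % M]'(Nat.mod_lt _ hM0)
  have hP : ∀ i (hi : i < M), P i = l[i] := by
    intro i hi
    simp only [P, Nat.mod_eq_of_lt hi]
  have hPmod : ∀ i, P (i % M) = P i := fun i => by simp only [P, Nat.mod_mod]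
  have hlink : ∀ i, Link (fun x y => c (Sum.inl x) (Sum.inr y)) (P i) (P (i + 1)) := by
    have key : ∀ i < M, Link (fun x y => c (Sum.inl x) (Sum.inr y)) (P i) (P (i + 1)) := by
      intro i hi
      have h1 := List.isChain_iff_getElem.1 hl i (by simp; omega)
      rw [List.getElem_append_left (by omega), ← hP i hi] at h1
      rcases Nat.lt_or_ge (i + 1) M with h2 | h2
      · rwa [List.getElem_append_left (by omega), ← hP (i + 1) h2] at h1
      · have h3 : i + 1 = M := by omega
        rw [List.getElem_append_right (by omega)] at h1
        have h4 : P (i + 1) = e := by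
          rw [← hPmod, h3, Nat.mod_self, hP 0 hM0]
          rw [List.head?_eq_getElem?, List.getElem?_eq_getElem hM0] at he
          exact Option.some.inj he
        rw [h4]
        simpa using h1
    intro i
    have h1 := key (i % M) (Nat.mod_lt _ hM0)
    rwa [hPmod, ← hPmod (i % M + 1), Nat.mod_add_mod, hPmod] at h1
  let g : ℕ → V2 n := fun j => if j % 2 = 0 then Sum.inl (P (j / 2)).1 else Sum.inr (P (j / 2)).2
  have g0 : ∀ t, g (2 * t) = Sum.inl (P t).1 := by
    intro t
    simp [g]
  have g1 : ∀ t, g (2 * t + 1) = Sum.inr (P t).2 := by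
    intro t
    have h1 : (2 * t + 1) / 2 = t := by omega
    have h2 : (2 * t + 1) % 2 ≠ 0 := by omega
    simp only [g, if_neg h2, h1]
  have hgmod : ∀ j, g (j % (2 * M)) = g j := by
    intro j
    rcases Nat.even_or_odd' j with ⟨t, rfl | rfl⟩
    · rw [Nat.mul_mod_mul_left, g0, g0, hPmod]
    · have h1 : (2 * t + 1) % (2 * M) = 2 * (t % M) + 1 := by
        have h2 := Nat.mod_add_div t M
        have h3 := Nat.mod_lt t hM0
        have h4 : 2 * t + 1 = 2 * (t % M) + 1 + 2 * M * (t / M) := by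
          rw [mul_assoc]; omega
        rw [h4, Nat.add_mul_mod_self_left, Nat.mod_eq_of_lt (by omega)]
      rw [h1, g1, g1, hPmod]
  let f : ZMod (2 * M) → V2 n := fun z => g z.val
  have hf : ∀ j : ℕ, f (j : ZMod (2 * M)) = g j := by
    intro j
    simp only [f, ZMod.val_natCast, hgmod]
  have hnd' : ∀ i < M, ∀ j < M, (P i).1 = (P j).1 ∨ (P i).2 = (P j).2 → i = j := by
    have hp := (List.nodup_flatMap.1 hnd).2
    rw [List.pairwise_iff_getElem] at hp
    have key : ∀ i j, i < j → j < M → ¬ ((P i).1 = (P j).1 ∨ (P i).2 = (P j).2) := by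
      intro i j hij hj hor
      have h1 := hp i j (by omega) hj hij
      rw [← hP i (by omega), ← hP j hj] at h1
      rcases hor with h2 | h2
      · exact h1 (a := Sum.inl (P i).1) (by simp [pairVerts]) (by simp [pairVerts, h2])
      · exact h1 (a := Sum.inr (P i).2) (by simp [pairVerts]) (by simp [pairVerts, h2])
    intro i hi j hj hor
    rcases lt_trichotomy i j with h1 | h1 | h1
    · exact absurd hor (key i j h1 hj)
    · exact h1
    · exact absurd (hor.imp Eq.symm Eq.symm) (key j i h1 hi)
  refine ⟨f, ⟨?_, ?_, ?_⟩, ?_⟩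
  · intro z z' hzz
    have h1 := ZMod.val_lt z
    have h2 := ZMod.val_lt z'
    apply ZMod.val_injective
    change g z.val = g z'.val at hzz
    rcases Nat.even_or_odd' z.val with ⟨t, ht | ht⟩ <;>
      rcases Nat.even_or_odd' z'.val with ⟨s, hs | hs⟩ <;> rw [ht, hs] at hzz ⊢
    · rw [g0, g0, Sum.inl.injEq] at hzz
      rw [hnd' t (by omega) s (by omega) (Or.inl hzz)]
    · rw [g0, g1] at hzz
      exact absurd hzz (by simp)
    · rw [g0, g1] at hzz
      exact absurd hzz (by simp)
    · rw [g1, g1, Sum.inr.injEq] at hzz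
      rw [hnd' t (by omega) s (by omega) (Or.inr hzz)]
  · intro z
    obtain ⟨j, rfl⟩ : ∃ j : ℕ, z = j := ⟨z.val, (ZMod.natCast_zmod_val z).symm⟩
    have h1 : ((j : ZMod (2 * M)) + 1) = ((j + 1 : ℕ) : ZMod (2 * M)) := by push_cast; ring
    rw [h1, hf, hf]
    rcases Nat.even_or_odd' j with ⟨t, rfl | rfl⟩
    · rw [g0, g1]
      simp [KBB]
    · rw [g1, show 2 * t + 1 + 1 = 2 * (t + 1) by ring, g0]
      simp [KBB]
  · intro z
    obtain ⟨j, rfl⟩ : ∃ j : ℕ, z = j := ⟨z.val, (ZMod.natCast_zmod_val z).symm⟩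
    have h1 : ((j : ZMod (2 * M)) + 1) = ((j + 1 : ℕ) : ZMod (2 * M)) := by push_cast; ring
    have h2 : ((j : ZMod (2 * M)) + 2) = ((j + 2 : ℕ) : ZMod (2 * M)) := by push_cast; ring
    rw [h1, h2, hf, hf, hf]
    rcases Nat.even_or_odd' j with ⟨t, rfl | rfl⟩
    · rw [g0, g1, show 2 * t + 2 = 2 * (t + 1) by ring, g0, hc (Sum.inr _)]
      exact (hlink t).1
    · rw [g1, show 2 * t + 1 + 1 = 2 * (t + 1) by ring,
        show 2 * t + 1 + 2 = 2 * (t + 1) + 1 by ring, g0, g1, hc (Sum.inr _)]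
      exact (hlink t).2
  · ext v
    simp only [Set.mem_range, Set.mem_ofPred_eq, edgeVerts, List.mem_flatMap]
    constructor
    · rintro ⟨z, rfl⟩
      refine ⟨P (z.val / 2), List.getElem_mem _, ?_⟩
      change g z.val ∈ _
      simp only [g, pairVerts]
      split_ifs <;> simp
    · rintro ⟨p, hp, hv⟩
      obtain ⟨i, hi, rfl⟩ := List.getElem_of_mem hp
      rw [← hP i hi] at hv
      simp only [pairVerts, List.mem_cons, List.not_mem_nil, or_false] at hv
      rcases hv with rfl | rfl
      · exact ⟨((2 * i : ℕ) : ZMod (2 * M)), by rw [hf, g0]⟩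
      · exact ⟨((2 * i + 1 : ℕ) : ZMod (2 * M)), by rw [hf, g1]⟩

lemma exists_edges_of_path_inl {n : ℕ} {c : V2 n → V2 n → ℕ} (hc : ∀ u v, c u v = c v u) :
    ∀ l : List (V2 n), l.IsChain (KBB n).Adj → PCL n c l → Even l.length →
      (∀ y, l.head? ≠ some (Sum.inr y)) →
      ∃ L : List (Fin n × Fin n), L.flatMap pairVerts = l ∧
        L.IsChain (Link fun x y => c (Sum.inl x) (Sum.inr y))
  | [], _, _, _, _ => ⟨[], rfl, List.isChain_nil⟩
  | [_], _, _, he, _ => by simp at he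
  | Sum.inr y :: _ :: _, _, _, _, hh => absurd rfl (hh y)
  | Sum.inl _ :: Sum.inl _ :: _, hl, _, _, _ => by simp [KBB] at hl
  | [Sum.inl x, Sum.inr y], _, _, _, _ => ⟨[(x, y)], rfl, List.isChain_singleton _⟩
  | Sum.inl _ :: Sum.inr _ :: Sum.inr _ :: _, hl, _, _, _ => by simp [KBB] at hl
  | [Sum.inl _, Sum.inr _, Sum.inl _], _, _, he, _ => by simp [Nat.even_iff] at he
  | Sum.inl x :: Sum.inr y :: Sum.inl x' :: b :: l, hl, hp, he, _ => by
    simp only [List.isChain_cons_cons] at hl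
    obtain ⟨L, hL, hch⟩ := exists_edges_of_path_inl hc (Sum.inl x' :: b :: l)
      (List.isChain_cons_cons.2 hl.2.2) hp.2.2
      (by simpa [Nat.even_add_one] using he) (by simp)
    cases L with
    | nil => simp at hL
    | cons p L =>
      obtain ⟨p1, p2⟩ := p
      simp only [List.flatMap_cons, pairVerts, List.cons_append, List.nil_append,
        List.cons.injEq, Sum.inl.injEq] at hL
      obtain ⟨rfl, rfl, rfl⟩ := hL
      refine ⟨(x, y) :: (p1, p2) :: L, by simp [pairVerts], ?_⟩
      refine List.isChain_cons_cons.2 ⟨⟨?_, ?_⟩, hch⟩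
      · simpa [hc (Sum.inr y)] using hp.1
      · simpa [hc (Sum.inr y)] using hp.2.1

lemma exists_edges_of_path_inr {n : ℕ} {c : V2 n → V2 n → ℕ} (hc : ∀ u v, c u v = c v u) :
    ∀ l : List (V2 n), l.IsChain (KBB n).Adj → PCL n c l → Even l.length →
      (∀ x, l.head? ≠ some (Sum.inl x)) →
      ∃ L : List (Fin n × Fin n), L.flatMap (fun p => (pairVerts p).reverse) = l ∧
        L.IsChain (fun p q => Link (fun x y => c (Sum.inl x) (Sum.inr y)) q p)
  | [], _, _, _, _ => ⟨[], rfl, List.isChain_nil⟩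
  | [_], _, _, he, _ => by simp at he
  | Sum.inl x :: _ :: _, _, _, _, hh => absurd rfl (hh x)
  | Sum.inr _ :: Sum.inr _ :: _, hl, _, _, _ => by simp [KBB] at hl
  | [Sum.inr y, Sum.inl x], _, _, _, _ => ⟨[(x, y)], rfl, List.isChain_singleton _⟩
  | Sum.inr _ :: Sum.inl _ :: Sum.inl _ :: _, hl, _, _, _ => by simp [KBB] at hl
  | [Sum.inr _, Sum.inl _, Sum.inr _], _, _, he, _ => by simp [Nat.even_iff] at he
  | Sum.inr y :: Sum.inl x :: Sum.inr y' :: b :: l, hl, hp, he, _ => by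
    simp only [List.isChain_cons_cons] at hl
    obtain ⟨L, hL, hch⟩ := exists_edges_of_path_inr hc (Sum.inr y' :: b :: l)
      (List.isChain_cons_cons.2 hl.2.2) hp.2.2
      (by simpa [Nat.even_add_one] using he) (by simp)
    cases L with
    | nil => simp at hL
    | cons p L =>
      obtain ⟨p1, p2⟩ := p
      simp only [List.flatMap_cons, pairVerts, List.reverse_cons, List.reverse_nil,
        List.cons_append, List.nil_append, List.cons.injEq, Sum.inr.injEq] at hL
      obtain ⟨rfl, rfl, rfl⟩ := hL
      refine ⟨(x, y) :: (p1, p2) :: L, by simp [pairVerts], ?_⟩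
      refine List.isChain_cons_cons.2 ⟨⟨?_, ?_⟩, hch⟩
      · have := hp.2.1
        rw [hc (Sum.inr p2)] at this
        exact this.symm
      · have := hp.1
        rw [hc (Sum.inr y)] at this
        exact this.symm

/-- A properly colored odd path is a chain of linked edges of `K_{n,n}`. -/
lemma IsPCOddPath.exists_edges {n : ℕ} {c : V2 n → V2 n → ℕ} (hc : ∀ u v, c u v = c v u)
    {l : List (V2 n)} (hl : IsPCOddPath n c l) :
    ∃ L : List (Fin n × Fin n), L ≠ [] ∧
      L.IsChain (Link fun x y => c (Sum.inl x) (Sum.inr y)) ∧ (edgeVerts L).Perm l := by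
  obtain ⟨⟨hne, -, hadj, hpc⟩, heven⟩ := hl
  by_cases h : ∀ y, l.head? ≠ some (Sum.inr y)
  · obtain ⟨L, rfl, hL⟩ := exists_edges_of_path_inl hc l hadj hpc heven h
    exact ⟨L, by rintro rfl; exact hne rfl, hL, List.Perm.refl _⟩
  · push Not at h
    obtain ⟨y, hy⟩ := h
    obtain ⟨L, rfl, hL⟩ := exists_edges_of_path_inr hc l hadj hpc heven (by simp [hy])
    refine ⟨L.reverse, ?_, List.isChain_reverse.2 hL, ?_⟩
    · intro h0
      rw [List.reverse_eq_nil_iff] at h0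
      subst h0
      exact hne rfl
    · exact ((List.reverse_perm L).flatMap_right _).trans
        (List.Perm.flatMap_left _ fun p _ => (List.reverse_perm _).symm)

lemma edgeVerts_flatMap_insertBlock_perm {n : ℕ}
    (I : (Fin n × Fin n) × (Fin n × Fin n) → List (Fin n × Fin n))
    (B : List (((Fin n × Fin n) × (Fin n × Fin n)) × (Fin n × Fin n))) :
    (edgeVerts (B.flatMap (insertBlock I))).Perm
      ((B.map Prod.fst).flatMap quadVerts ++ edgeVerts (B.map Prod.snd) ++
        (B.map Prod.fst).flatMap fun t => edgeVerts (I t)) := by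
  simp only [edgeVerts, List.flatMap_assoc, List.flatMap_map]
  refine List.Perm.trans ?_ (((List.flatMap_append_perm _ _ _).append_right _).trans
    (List.flatMap_append_perm _ _ _)).symm
  refine List.Perm.flatMap_left _ fun s _ => ?_
  simp only [insertBlock, quadVerts, List.flatMap_cons, List.flatMap_append, List.flatMap_nil,
    List.append_nil, List.append_assoc]
  refine List.Perm.append_left _ ?_
  rw [← List.append_assoc (pairVerts _)]
  exact List.perm_append_comm.trans (by simp)

lemma eventually_pow_four_mul_lt {θ : ℝ} (hθ : 0 < θ) :
    ∀ᶠ n : ℕ in Filter.atTop,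
      (n : ℝ) ^ 4 * (31 / 32) ^ ⌊θ * n⌋₊ < (1 / 2) ^ (⌊θ * n⌋₊ / 40) := by
  have hK : Filter.Tendsto (fun n : ℕ => ⌊θ * (n : ℝ)⌋₊ / 40) Filter.atTop Filter.atTop :=
    (Nat.tendsto_div_const_atTop (by norm_num)).comp (tendsto_nat_floor_atTop.comp
      (tendsto_natCast_atTop_atTop.const_mul_atTop hθ))
  have hlim := tendsto_pow_const_mul_const_pow_of_abs_lt_one 4
    (r := (3 / 5 : ℝ)) (by rw [abs_of_pos] <;> norm_num)
  have hsmall := hlim.eventually_lt_const (u := 1 / (80 / θ) ^ 4) (by positivity)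
  filter_upwards [hK.eventually hsmall, hK.eventually_ge_atTop 1] with n h1 h2
  set N := ⌊θ * (n : ℝ)⌋₊
  set K := N / 40 with hKdef
  have hn : (n : ℝ) ≤ 80 / θ * K := by
    have h3 : θ * n < N + 1 := Nat.lt_floor_add_one _
    have h4 : N + 1 ≤ 80 * K := by omega
    have h5 : (N : ℝ) + 1 ≤ 80 * K := by exact_mod_cast h4
    rw [div_mul_eq_mul_div, le_div_iff₀ hθ]
    linarith
  have hpow : (31 / 32 : ℝ) ^ N ≤ (3 / 5) ^ K * (1 / 2) ^ K := by
    calc (31 / 32 : ℝ) ^ N ≤ (31 / 32) ^ (40 * K) :=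
          pow_le_pow_of_le_one (by norm_num) (by norm_num) (by omega)
      _ = ((31 / 32) ^ 40) ^ K := pow_mul _ _ _
      _ ≤ (3 / 5 * (1 / 2)) ^ K := by
          gcongr
          norm_num
      _ = _ := mul_pow _ _ _
  rw [lt_div_iff₀ (by positivity)] at h1
  calc (n : ℝ) ^ 4 * (31 / 32) ^ N
      ≤ (80 / θ * K) ^ 4 * ((3 / 5) ^ K * (1 / 2) ^ K) := by gcongr
    _ = (K : ℝ) ^ 4 * (3 / 5) ^ K * (80 / θ) ^ 4 * (1 / 2) ^ K := by ring
    _ < 1 * (1 / 2) ^ K := by gcongr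
    _ = _ := one_mul _

/-- Lemma 3.9 (absorbing cycle).  For every `ε > 0` there is `n₀(ε)` such
that every edge-colored `K_{n,n}` with `n ≥ n₀` and `δ^c ≥ (2/3 + ε)n` contains a PC
cycle `C` of length at most `(2/3)ε²n` such that for every positive `k ≤ 2ε⁴n/81` and
every `k` vertex-disjoint PC odd paths `Q₁, …, Q_k` avoiding `V(C)`, there is a PC cycle
`C'` with `V(C') = V(C) ∪ ⋃ V(Qᵢ)`. -/
theorem absorbing_cycle (ε : ℝ) (hε : 0 < ε) :
    ∃ n₀ : ℕ, ∀ n : ℕ, n₀ ≤ n → ∀ c : V2 n → V2 n → ℕ, (∀ u v, c u v = c v u) →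
      (∀ v, ((2 : ℝ) / 3 + ε) * n ≤ (colorDeg n c v : ℝ)) →
      ∃ (m : ℕ) (f : ZMod m → V2 n), IsPCCycle n c m f ∧
        (m : ℝ) ≤ 2 / 3 * ε ^ 2 * n ∧
        ∀ k : ℕ, 0 < k → (k : ℝ) ≤ 2 * ε ^ 4 * n / 81 →
          ∀ Q : Fin k → List (V2 n),
            (∀ i, IsPCOddPath n c (Q i)) →
            (∀ i j, i ≠ j → ∀ v : V2 n, v ∈ Q i → v ∉ Q j) →
            (∀ (i : Fin k) (v : V2 n), v ∈ Q i → v ∉ Set.range f) →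
            ∃ (m' : ℕ) (g : ZMod m' → V2 n), IsPCCycle n c m' g ∧
              Set.range g = Set.range f ∪ ⋃ i, {v | v ∈ Q i} := by
  classical
  obtain ⟨n₁, hn₁⟩ := Filter.eventually_atTop.1
    (eventually_pow_four_mul_lt (θ := ε ^ 2 / 9) (by positivity))
  refine ⟨max (max n₁ 18) (max ⌈2 / ε⌉₊ ⌈9 / ε ^ 2⌉₊), fun n hn c hc hdeg => ?_⟩
  simp only [max_le_iff] at hn
  obtain ⟨⟨hnn₁, hn18⟩, hnε, hnε2⟩ := hn
  have hweight := hn₁ n hnn₁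
  have hn0 : 0 < n := by omega
  have hnr : (18 : ℝ) ≤ n := by exact_mod_cast hn18
  have hεn : 2 ≤ ε * n := by
    rw [mul_comm, ← div_le_iff₀ hε]
    exact Nat.ceil_le.1 hnε
  have hε2n : 1 ≤ ε ^ 2 / 9 * n := by
    have h1 := Nat.ceil_le.1 hnε2
    rw [div_le_iff₀ (by positivity)] at h1
    linarith
  have hε3 : ε ≤ 1 / 3 := by
    have h1 := hdeg (Sum.inl ⟨0, hn0⟩)
    have h2 : colorDeg n c (Sum.inl ⟨0, hn0⟩) ≤ n := by
      refine Finset.card_image_le.trans ?_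
      simp
    have h3 : (colorDeg n c (Sum.inl ⟨0, hn0⟩) : ℝ) ≤ n := by exact_mod_cast h2
    nlinarith
  set N := ⌊ε ^ 2 / 9 * n⌋₊ with hN
  have hNle : (N : ℝ) ≤ ε ^ 2 / 9 * n := Nat.floor_le (by positivity)
  have hN1 : 1 ≤ N := Nat.le_floor (by exact_mod_cast hε2n)
  have hNε : (N : ℝ) ≤ ε * n / 27 := by
    have : ε ^ 2 * n ≤ 1 / 3 * (ε * n) := by nlinarith
    linarith
  set C : Fin n → Fin n → ℕ := fun x y => c (Sum.inl x) (Sum.inr y) with hC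
  set D := ⌈(2 / 3 + ε) * (n : ℝ)⌉₊
  have hDle : (2 / 3 + ε) * (n : ℝ) ≤ D := Nat.le_ceil _
  have hrich : ColorRich C D := by
    refine ⟨fun x S => ?_, fun y S => ?_⟩
    · exact (Nat.ceil_le.2 (hdeg (Sum.inl x))).trans
        (card_image_le_card_add_filter (fun y => C x y) S)
    · simp only [hC, hc (Sum.inl _)]
      exact (Nat.ceil_le.2 (hdeg (Sum.inr y))).trans
        (card_image_le_card_add_filter (fun x => c (Sum.inr y) (Sum.inl x)) S)
  obtain ⟨ts, hlen, htnd, htlink, htw⟩ := hrich.exists_quads (N := N) hn0 (by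
    have : (n : ℝ) + 2 * (3 + 4 * N) ≤ 2 * D := by linarith
    exact_mod_cast this) N le_rfl
  have hmany : ∀ q, N / 40 ≤ (ts.toFinset.filter (AbsorbsPair C q)).card := by
    intro q
    by_contra! hlt
    have h1 : (1 / 2 : ℝ) ^ (ts.toFinset.filter (AbsorbsPair C q)).card <
        (1 / 2 : ℝ) ^ (N / 40) :=
      ((Finset.single_le_sum (f := fun q => (1 / 2 : ℝ) ^
        (ts.toFinset.filter (AbsorbsPair C q)).card) (fun q _ => by positivity)
        (Finset.mem_univ q)).trans htw).trans_lt hweight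
    exact absurd (pow_le_pow_of_le_one (by norm_num) (by norm_num) hlt.le) (not_le.2 h1)
  obtain ⟨t₀, ts', rfl⟩ : ∃ t ts', ts = t :: ts' :=
    List.exists_cons_of_ne_nil (by rintro rfl; simp at hlen; omega)
  set ts := t₀ :: ts' with hts
  obtain ⟨B, hB, hBchain, hBnd, hBav⟩ := hrich.exists_connected ts t₀.1 htlink
    (ts.flatMap quadVerts).toFinset (by
      have h1 := List.toFinset_card_le (ts.flatMap quadVerts)
      rw [length_flatMap_quadVerts, hlen] at h1
      have h2 : 2 * (n : ℝ) + 3 + (4 * N + 2 * N) < 3 * D := by linarith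
      have h3 : 2 * n + 3 + (4 * N + 2 * N) < 3 * D := by exact_mod_cast h2
      omega)
  have hbase : B.flatMap baseBlock = B.flatMap (insertBlock fun _ => []) := rfl
  have hlenB : (B.flatMap baseBlock).length = 3 * N := by
    rw [← hlen, ← hB]
    simp [baseBlock, List.length_flatMap, mul_comm]
  obtain ⟨s₀, B', rfl⟩ : ∃ s B', B = s :: B' :=
    List.exists_cons_of_ne_nil (by rintro rfl; simp [hts] at hB)
  set B := s₀ :: B' with hBdef
  have hs₀ : s₀.1 = t₀ := by
    rw [hBdef, hts, List.map_cons] at hB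
    exact (List.cons.inj hB).1
  have hnd0 : (ts.flatMap quadVerts ++ edgeVerts (B.map Prod.snd)).Nodup :=
    htnd.append hBnd fun v hv hv' => hBav v hv' (List.mem_toFinset.2 hv)
  have hperm0 : (edgeVerts (B.flatMap baseBlock)).Perm
      (ts.flatMap quadVerts ++ edgeVerts (B.map Prod.snd)) := by
    have := edgeVerts_flatMap_insertBlock_perm (fun _ => []) B
    have hnil : (ts.flatMap fun _ => edgeVerts ([] : List (Fin n × Fin n))) = [] :=
      List.flatMap_eq_nil_iff.2 fun _ _ => rfl
    rwa [hB, hnil, List.append_nil, ← hbase] at this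
  obtain ⟨f, hf, hfr⟩ := exists_isPCCycle_of_chain hc (B.flatMap baseBlock) (by omega) t₀.1
    (by simp [hBdef, baseBlock, hs₀]) hBchain (hperm0.nodup_iff.2 hnd0)
  refine ⟨_, f, hf, ?_, ?_⟩
  · rw [hlenB]
    push_cast
    linarith
  intro k hk0 hk Q hQ hQdisj hQf
  have hkN : k ≤ N / 40 := by
    rw [Nat.le_div_iff_mul_le (by norm_num)]
    refine Nat.le_floor ?_
    have h1 : ε ^ 2 ≤ 1 / 9 := by nlinarith
    have h2 : ε ^ 4 * n ≤ 1 / 9 * (ε ^ 2 * n) := by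
      have : 0 ≤ ε ^ 2 * n := by positivity
      nlinarith
    have h3 : 0 ≤ ε ^ 2 * n := by positivity
    push_cast
    linarith
  choose L hLne hLchain hLperm using fun i => (hQ i).exists_edges hc
  obtain ⟨σ, hσ, hσA⟩ := (Finset.all_card_le_biUnion_card_iff_exists_injective fun i =>
    ts.toFinset.filter (AbsorbsPair C ((L i).head (hLne i), (L i).getLast (hLne i)))).1 (by
      intro s
      rcases s.eq_empty_or_nonempty with rfl | ⟨i, hi⟩
      · simp
      · calc s.card ≤ k := by simpa using s.card_le_univ
          _ ≤ _ := hkN.trans (hmany _)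
          _ ≤ _ := Finset.card_le_card (Finset.subset_biUnion_of_mem (fun i =>
            ts.toFinset.filter
              (AbsorbsPair C ((L i).head (hLne i), (L i).getLast (hLne i)))) hi))
  set I := Function.extend σ L fun _ => []
  have hIσ : ∀ i, I (σ i) = L i := fun i => hσ.extend_apply _ _ i
  have hInil : ∀ t, (¬ ∃ i, σ i = t) → I t = [] := fun t ht => Function.extend_apply' _ _ t ht
  have hσts : ∀ i, σ i ∈ ts := fun i => List.mem_toFinset.1 (Finset.mem_filter.1 (hσA i)).1
  have hmemI : ∀ v, v ∈ ts.flatMap (fun t => edgeVerts (I t)) ↔ ∃ i, v ∈ Q i := by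
    intro v
    rw [List.mem_flatMap]
    constructor
    · rintro ⟨t, -, hv⟩
      by_cases ht : ∃ i, σ i = t
      · obtain ⟨i, rfl⟩ := ht
        rw [hIσ] at hv
        exact ⟨i, (hLperm i).mem_iff.1 hv⟩
      · rw [hInil t ht] at hv
        simp [edgeVerts] at hv
    · rintro ⟨i, hv⟩
      exact ⟨σ i, hσts i, by rw [hIσ]; exact (hLperm i).mem_iff.2 hv⟩
  have hndI : (ts.flatMap fun t => edgeVerts (I t)).Nodup := by
    refine List.nodup_flatMap.2 ⟨fun t _ => ?_, ?_⟩
    · by_cases ht : ∃ i, σ i = t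
      · obtain ⟨i, rfl⟩ := ht
        rw [hIσ]
        exact (hLperm i).nodup_iff.2 (hQ i).1.2.1
      · rw [hInil t ht]
        simp [edgeVerts]
    · have htsnd : ts.Nodup := by
        refine List.Pairwise.imp_of_mem ?_ (List.nodup_flatMap.1 htnd).2
        rintro s t - - hst rfl
        exact hst (a := Sum.inl s.1.1) (by simp [quadVerts, pairVerts])
          (by simp [quadVerts, pairVerts])
      refine List.Pairwise.imp_of_mem ?_ htsnd
      intro s t _ _ hst v hv hv'
      change v ∈ edgeVerts (I s) at hv
      change v ∈ edgeVerts (I t) at hv'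
      by_cases hs : ∃ i, σ i = s
      · by_cases ht : ∃ i, σ i = t
        · obtain ⟨i, rfl⟩ := hs
          obtain ⟨j, rfl⟩ := ht
          rw [hIσ] at hv hv'
          exact hQdisj i j (fun e => hst (by rw [e])) v ((hLperm i).mem_iff.1 hv)
            ((hLperm j).mem_iff.1 hv')
        · rw [hInil t ht] at hv'
          simp [edgeVerts] at hv'
      · rw [hInil s hs] at hv
        simp [edgeVerts] at hv
  have hperm : (edgeVerts (B.flatMap (insertBlock I))).Perm
      (edgeVerts (B.flatMap baseBlock) ++ ts.flatMap fun t => edgeVerts (I t)) := by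
    have h1 := edgeVerts_flatMap_insertBlock_perm I B
    rw [hB] at h1
    exact h1.trans (hperm0.symm.append_right _)
  have hchain : (B.flatMap (insertBlock I) ++ [t₀.1]).IsChain (Link C) := by
    refine isChain_flatMap_insertBlock I t₀.1 B hBchain fun s hs => ?_
    have hsts : s.1 ∈ ts := hB ▸ List.mem_map_of_mem hs
    by_cases hsσ : ∃ i, σ i = s.1
    · obtain ⟨i, hi⟩ := hsσ
      have hA := (Finset.mem_filter.1 (hσA i)).2
      rw [← hi, hIσ, List.isChain_cons, List.isChain_append]
      refine ⟨?_, hLchain i, List.isChain_singleton _, ?_⟩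
      · intro y hy
        rw [List.head?_append_of_ne_nil _ (hLne i), List.head?_eq_some_head (hLne i)] at hy
        cases hy
        exact hA.1
      · intro x hx y hy
        rw [List.getLast?_eq_some_getLast (hLne i)] at hx
        cases hx
        cases hy
        exact hA.2
    · rw [hInil _ hsσ]
      simpa using htlink _ hsts
  obtain ⟨g, hg, hgr⟩ := exists_isPCCycle_of_chain hc (B.flatMap (insertBlock I))
    (by
      have h1 := hperm.length_eq
      rw [List.length_append, length_edgeVerts, length_edgeVerts] at h1
      omega) t₀.1 (by simp [hBdef, insertBlock, hs₀]) hchain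
    (by
      refine hperm.nodup_iff.2 ((hperm0.nodup_iff.2 hnd0).append hndI fun v hv hv' => ?_)
      obtain ⟨i, hi⟩ := (hmemI v).1 hv'
      exact hQf i v hi (by rw [hfr]; exact hv))
  refine ⟨_, g, hg, ?_⟩
  rw [hgr, hfr]
  ext v
  simp only [Set.mem_ofPred_eq, Set.mem_union, Set.mem_iUnion, hperm.mem_iff, List.mem_append,
    hmemI]
end

section
/- Let t ≥ 3 be an integer and let G = K^c_{n,n} be an edge-colored complete balanced bipartite graph with δ^c(G) ≥ 2n/3 + t that contains no properly colored 2^(t)-factor. Let H be a 1^(t)-path-cycle of G with unique path component P chosen so that |V(H)| is as large as possible and, subject to that, |V(P)| is as large as possible, and suppose k = |V(P)| is even. Then the induced edge-colored subgraph G[V(H)] has a properly colored 2^(t)-factor. -/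
open SimpleGraph

section

variable {n : ℕ} {c : V2 n → V2 n → ℕ}

lemma kbb_adj_iff (a b : V2 n) : (KBB n).Adj a b ↔ a.isLeft ≠ b.isLeft := by
  rcases a with a | a <;> rcases b with b | b <;> simp [KBB]

/-- `p 0, …, p (k - 1)` is a properly colored path. -/
structure IsPCSeq (n : ℕ) (c : V2 n → V2 n → ℕ) (k : ℕ) (p : ℕ → V2 n) : Prop where
  inj : ∀ i < k, ∀ j < k, p i = p j → i = j
  adj : ∀ i, i + 1 < k → (KBB n).Adj (p i) (p (i + 1))
  pc : ∀ i, i + 2 < k → c (p i) (p (i + 1)) ≠ c (p (i + 1)) (p (i + 2))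

lemma pcl_iff_getElem (l : List (V2 n)) :
    PCL n c l ↔ ∀ i (h : i + 2 < l.length), c l[i] l[i + 1] ≠ c l[i + 1] l[i + 2] := by
  induction l with
  | nil => simp [PCL]
  | cons a l ih =>
    match l, ih with
    | [], _ => simp [PCL]
    | [b], _ => simp [PCL]
    | b :: d :: r, ih =>
      rw [PCL, ih]
      constructor
      · rintro ⟨h0, h⟩ i hi
        cases i with
        | zero => simpa using h0
        | succ i => exact h i (by simpa using hi)
      · intro h
        refine ⟨by simpa using h 0 (by simp), fun i hi => ?_⟩
        exact h (i + 1) (by simpa using hi)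

lemma IsPCSeq.isPCPath {k : ℕ} {p : ℕ → V2 n} (hp : IsPCSeq n c k p) (hk : 0 < k) :
    IsPCPath n c ((List.range k).map p) := by
  refine ⟨by simp; omega, ?_, ?_, ?_⟩
  · refine List.Nodup.map_on ?_ List.nodup_range
    intro i hi j hj
    exact hp.inj i (by simpa using hi) j (by simpa using hj)
  · refine List.isChain_iff_getElem.2 fun i hi => ?_
    simpa using hp.adj i (by simpa using hi)
  · refine (pcl_iff_getElem _).2 fun i hi => ?_
    simpa using hp.pc i (by simpa using hi)

lemma IsPCPath.exists_seq {l : List (V2 n)} (hl : IsPCPath n c l) :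
    ∃ p : ℕ → V2 n, IsPCSeq n c l.length p ∧ ∀ v, v ∈ l ↔ ∃ i < l.length, p i = v := by
  obtain ⟨h0, hnd, hch, hpc⟩ := hl
  have key : ∀ i (h : i < l.length), l.getD i (l.head h0) = l[i] := fun i h => by simp [h]
  refine ⟨fun i => l.getD i (l.head h0), ⟨fun i hi j hj hij => ?_, fun i hi => ?_, fun i hi => ?_⟩,
    fun v => ?_⟩
  · rw [key i hi, key j hj] at hij
    exact (hnd.getElem_inj_iff).1 hij
  · rw [key i (by omega), key _ hi]
    exact List.isChain_iff_getElem.1 hch i hi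
  · rw [key i (by omega), key (i + 1) (by omega), key _ hi]
    exact (pcl_iff_getElem l).1 hpc i hi
  · rw [List.mem_iff_getElem]
    constructor
    · rintro ⟨i, hi, h⟩
      exact ⟨i, hi, by rw [← h]; exact key i hi⟩
    · rintro ⟨i, hi, h⟩
      exact ⟨i, hi, by rw [← h]; exact (key i hi).symm⟩

lemma IsPCSeq.reverse (hsym : ∀ u v, c u v = c v u) {k : ℕ} {p : ℕ → V2 n}
    (hp : IsPCSeq n c k p) : IsPCSeq n c k (fun i => p (k - 1 - i)) := by
  refine ⟨fun i hi j hj hij => ?_, fun i hi => ?_, fun i hi => ?_⟩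
  · have := hp.inj _ (by omega) _ (by omega) hij
    omega
  · have := (hp.adj (k - 1 - (i + 1)) (by omega)).symm
    rwa [show k - 1 - (i + 1) + 1 = k - 1 - i by omega] at this
  · have := hp.pc (k - 1 - (i + 2)) (by omega)
    rw [show k - 1 - (i + 2) + 1 = k - 1 - (i + 1) by omega,
      show k - 1 - (i + 2) + 2 = k - 1 - i by omega] at this
    intro h
    apply this
    rw [hsym (p (k - 1 - (i + 2))), hsym (p (k - 1 - (i + 1))) (p (k - 1 - i))]
    exact h.symm

lemma IsPCSeq.isLeft_iff {k : ℕ} {p : ℕ → V2 n} (hp : IsPCSeq n c k p) :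
    ∀ i < k, ((p i).isLeft = (p 0).isLeft ↔ Even i) := by
  intro i
  induction i with
  | zero => simp
  | succ i ih =>
    intro hi
    have h1 := ih (by omega)
    have h2 := (kbb_adj_iff _ _).1 (hp.adj i hi)
    rw [Nat.even_add_one, ← h1]
    revert h2
    generalize (p i).isLeft = a, (p (i + 1)).isLeft = b, (p 0).isLeft = d
    revert a b d
    decide

lemma IsPCSeq.adj_iff {k : ℕ} {p : ℕ → V2 n} (hp : IsPCSeq n c k p) {i j : ℕ}
    (hi : i < k) (hj : j < k) : (KBB n).Adj (p i) (p j) ↔ ¬ Even (i + j) := by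
  rw [kbb_adj_iff, Nat.even_add, ← hp.isLeft_iff i hi, ← hp.isLeft_iff j hj]
  generalize (p i).isLeft = a, (p j).isLeft = b, (p 0).isLeft = d
  revert a b d
  decide

open Classical in
/-- The vertices in the part of `K_{n,n}` not containing `v`. -/
noncomputable def opposite (v : V2 n) : Finset (V2 n) := Finset.univ.filter ((KBB n).Adj v)

lemma mem_opposite {v w : V2 n} : w ∈ opposite v ↔ (KBB n).Adj v w := by simp [opposite]

lemma opposite_inl (a : Fin n) :
    opposite (Sum.inl a) = Finset.univ.map (Function.Embedding.inr : Fin n ↪ V2 n) := by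
  ext w; rcases w with w | w <;> simp [mem_opposite, KBB]

lemma opposite_inr (a : Fin n) :
    opposite (Sum.inr a) = Finset.univ.map (Function.Embedding.inl : Fin n ↪ V2 n) := by
  ext w; rcases w with w | w <;> simp [mem_opposite, KBB]

lemma card_opposite (v : V2 n) : (opposite v).card = n := by
  rcases v with v | v <;> simp [opposite_inl, opposite_inr]

lemma colorDeg_eq (v : V2 n) : colorDeg n c v = ((opposite v).image (c v)).card := by
  rcases v with v | v
  · rw [opposite_inl, Finset.map_eq_image, Finset.image_image]; rfl
  · rw [opposite_inr, Finset.map_eq_image, Finset.image_image]; rfl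

lemma colorDeg_le_card_ne_add_one (v : V2 n) (κ : ℕ) :
    colorDeg n c v ≤ ((opposite v).filter fun w => c v w ≠ κ).card + 1 := by
  rw [colorDeg_eq]
  calc ((opposite v).image (c v)).card
      ≤ (insert κ (((opposite v).filter fun w => c v w ≠ κ).image (c v))).card := by
        refine Finset.card_le_card fun d hd => ?_
        obtain ⟨w, hw, rfl⟩ := Finset.mem_image.1 hd
        by_cases h : c v w = κ
        · simp [h]
        · exact Finset.mem_insert_of_mem
            (Finset.mem_image_of_mem _ (Finset.mem_filter.2 ⟨hw, h⟩))
    _ ≤ _ := (Finset.card_insert_le _ _).trans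
        (Nat.add_le_add_right Finset.card_image_le 1)

lemma card_eq_add_colorDeg_le (v : V2 n) (κ : ℕ) :
    ((opposite v).filter fun w => c v w = κ).card + colorDeg n c v ≤ n + 1 := by
  have h1 := colorDeg_le_card_ne_add_one (c := c) v κ
  have h2 := Finset.card_filter_add_card_filter_not (s := opposite v) (fun w => c v w = κ)
  rw [card_opposite] at h2
  simp only [ne_eq] at h1
  omega

/-- `F` is a properly colored `2`-factor on the vertex set `S` in which every component has at
least `t` vertices. -/
structure IsFactorOn (n : ℕ) (c : V2 n → V2 n → ℕ) (S : Set (V2 n)) (F : SimpleGraph (V2 n))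
    (t : ℕ) : Prop where
  le : F ≤ KBB n
  mem : ∀ a b, F.Adj a b → a ∈ S
  two : ∀ a ∈ S, ∃ y z, c a y ≠ c a z ∧ ∀ b, F.Adj a b ↔ b = y ∨ b = z
  closed : ∀ W : Set (V2 n), W ⊆ S → W.Nonempty → (∀ a ∈ W, ∀ b, F.Adj a b → b ∈ W) →
    t ≤ W.ncard

lemma IsFactorOn.sup {S₁ S₂ : Set (V2 n)} {F₁ F₂ : SimpleGraph (V2 n)} {t : ℕ}
    (h₁ : IsFactorOn n c S₁ F₁ t) (h₂ : IsFactorOn n c S₂ F₂ t) (hd : Disjoint S₁ S₂) :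
    IsFactorOn n c (S₁ ∪ S₂) (F₁ ⊔ F₂) t := by
  have n₁ : ∀ a ∈ S₁, ∀ b, ¬ F₂.Adj a b := fun a ha b h =>
    Set.disjoint_left.1 hd ha (h₂.mem a b h)
  have n₂ : ∀ a ∈ S₂, ∀ b, ¬ F₁.Adj a b := fun a ha b h =>
    Set.disjoint_left.1 hd (h₁.mem a b h) ha
  refine ⟨sup_le h₁.le h₂.le, ?_, ?_, ?_⟩
  · rintro a b (h | h)
    · exact Or.inl (h₁.mem a b h)
    · exact Or.inr (h₂.mem a b h)
  · rintro a (ha | ha)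
    · obtain ⟨y, z, hc, h⟩ := h₁.two a ha
      exact ⟨y, z, hc, fun b => by simp [n₁ a ha, h]⟩
    · obtain ⟨y, z, hc, h⟩ := h₂.two a ha
      exact ⟨y, z, hc, fun b => by simp [n₂ a ha, h]⟩
  · rintro W hWS ⟨a, ha⟩ hW
    rcases hWS ha with haS | haS
    · refine (h₁.closed (W ∩ S₁) Set.inter_subset_right ⟨a, ha, haS⟩ ?_).trans
        (Set.ncard_le_ncard Set.inter_subset_left W.toFinite)
      rintro x ⟨hx, -⟩ b hb
      exact ⟨hW x hx b (Or.inl hb), h₁.mem b x hb.symm⟩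
    · refine (h₂.closed (W ∩ S₂) Set.inter_subset_right ⟨a, ha, haS⟩ ?_).trans
        (Set.ncard_le_ncard Set.inter_subset_left W.toFinite)
      rintro x ⟨hx, -⟩ b hb
      exact ⟨hW x hx b (Or.inr hb), h₂.mem b x hb.symm⟩

lemma IsFactorOn.isPC2FactorOn {S : Set (V2 n)} {F : SimpleGraph (V2 n)} {t : ℕ}
    (h : IsFactorOn n c S F t) : IsPC2FactorOn n c S F t := by
  have hcard : ∀ v ∈ S, (F.neighborSet v).ncard = 2 := by
    intro v hv
    obtain ⟨y, z, hc, hN⟩ := h.two v hv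
    have : F.neighborSet v = {y, z} := by ext b; simp [hN]
    rw [this, Set.ncard_pair]
    rintro rfl
    exact hc rfl
  refine ⟨h.le, h.mem, hcard, ?_, ?_⟩
  · intro u v w huv huw hvw
    obtain ⟨y, z, hc, hN⟩ := h.two u (h.mem _ _ huv)
    rcases (hN v).1 huv with rfl | rfl <;> rcases (hN w).1 huw with rfl | rfl
    · exact absurd rfl hvw
    · exact hc
    · exact hc.symm
    · exact absurd rfl hvw
  · intro v p hp
    have hsub : ∀ a ∈ p.support, a ∈ S ∧ ∀ b, F.Adj a b → b ∈ p.support := by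
      intro a ha
      have h2 := hp.ncard_neighborSet_toSubgraph_eq_two ha
      have hle : p.toSubgraph.neighborSet a ⊆ F.neighborSet a :=
        p.toSubgraph.neighborSet_subset a
      have haS : a ∈ S := by
        obtain ⟨b, hb⟩ := Set.nonempty_of_ncard_ne_zero (by rw [h2]; decide)
        exact h.mem a b (hle hb)
      refine ⟨haS, fun b hb => ?_⟩
      have heq := Set.eq_of_subset_of_ncard_le hle (by rw [h2, hcard a haS]) (Set.toFinite _)
      have hb' : b ∈ p.toSubgraph.neighborSet a := by rw [heq]; exact hb
      have := p.toSubgraph.edge_vert (p.toSubgraph.adj_symm hb')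
      simpa using this
    have h1 := h.closed {a | a ∈ p.support} (fun a ha => (hsub a ha).1) ⟨v, by simp⟩
      (fun a ha => (hsub a ha).2)
    refine h1.trans ?_
    have : {a | a ∈ p.support} ⊆ (p.support.tail.toFinset : Set (V2 n)) := by
      intro a ha
      have ha' : a ∈ p.support := ha
      simp only [List.coe_toFinset, Set.mem_ofPred_eq]
      rw [← p.cons_tail_support, List.mem_cons] at ha'
      rcases ha' with rfl | h
      · exact SimpleGraph.Walk.end_mem_tail_support hp.not_nil
      · exact h
    calc _ ≤ (p.support.tail.toFinset : Set (V2 n)).ncard := Set.ncard_le_ncard this (Set.toFinite _)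
      _ = p.support.tail.toFinset.card := Set.ncard_coe_finset _
      _ ≤ p.support.tail.length := List.toFinset_card_le _
      _ = p.length := by simp

lemma exists_factor_cycles {t : ℕ} (H : OnePathCycleT n c t) (hsym : ∀ u v, c u v = c v u)
    (ht : 3 ≤ t) : ∃ F, IsFactorOn n c (⋃ i, Set.range (H.cyc i)) F t := by
  have hlen : ∀ i, NeZero (H.cycLen i) := fun i => ⟨by have := H.cyc_long i; omega⟩
  have hcyc : ∀ i i' j j', H.cyc i j = H.cyc i' j' → ∃ h : i = i', h ▸ j = j' := by
    intro i i' j j' h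
    by_cases hi : i = i'
    · subst hi
      exact ⟨rfl, (H.cyc_pc i).1 h⟩
    · exact absurd h (H.disj_cyc_cyc i i' hi j j')
  let F : SimpleGraph (V2 n) :=
    { Adj := fun a b => ∃ i j, (a = H.cyc i j ∧ b = H.cyc i (j + 1)) ∨
        (b = H.cyc i j ∧ a = H.cyc i (j + 1))
      symm := by
        constructor
        rintro a b ⟨i, j, h⟩
        exact ⟨i, j, h.symm⟩
      loopless := by
        constructor
        rintro a ⟨i, j, ⟨rfl, h⟩ | ⟨rfl, h⟩⟩ <;>
        · have := (H.cyc_pc i).2.1 j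
          rw [← h] at this
          exact (KBB n).loopless.irrefl _ this }
  refine ⟨F, ?_, ?_, ?_, ?_⟩
  · rintro a b ⟨i, j, ⟨rfl, rfl⟩ | ⟨rfl, rfl⟩⟩
    · exact (H.cyc_pc i).2.1 j
    · exact ((H.cyc_pc i).2.1 j).symm
  · rintro a b ⟨i, j, ⟨rfl, rfl⟩ | ⟨rfl, rfl⟩⟩ <;> exact Set.mem_iUnion.2 ⟨i, _, rfl⟩
  · rintro a ha
    obtain ⟨i, j, rfl⟩ : ∃ i j, H.cyc i j = a := by simpa using ha
    refine ⟨H.cyc i (j - 1), H.cyc i (j + 1), ?_, fun b => ?_⟩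
    · have := (H.cyc_pc i).2.2 (j - 1)
      rw [show j - 1 + 1 = j by ring, show j - 1 + 2 = j + 1 by ring, hsym] at this
      exact this
    · constructor
      · rintro ⟨i', j', ⟨h, rfl⟩ | ⟨rfl, h⟩⟩
        · obtain ⟨rfl, rfl⟩ := hcyc _ _ _ _ h
          exact Or.inr rfl
        · obtain ⟨rfl, h⟩ := hcyc _ _ _ _ h
          simp only at h
          subst h
          left; congr 1; ring
      · rintro (rfl | rfl)
        · exact ⟨i, j - 1, Or.inr ⟨rfl, by congr 1; ring⟩⟩
        · exact ⟨i, j, Or.inl ⟨rfl, rfl⟩⟩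
  · rintro W hWS ⟨a, ha⟩ hW
    obtain ⟨i, j, rfl⟩ : ∃ i j, H.cyc i j = a := by simpa using hWS ha
    have hall : ∀ m : ℕ, H.cyc i (j + m) ∈ W := by
      intro m
      induction m with
      | zero => simpa using ha
      | succ m ih =>
        refine hW _ ih _ ⟨i, j + m, Or.inl ⟨rfl, ?_⟩⟩
        push_cast
        congr 1
        ring
    have hsub : Set.range (H.cyc i) ⊆ W := by
      rintro _ ⟨j', rfl⟩
      have := hall (j' - j).val
      rwa [ZMod.natCast_zmod_val, add_sub_cancel] at this
    calc t ≤ H.cycLen i := H.cyc_long i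
      _ = Nat.card (ZMod (H.cycLen i)) := (Nat.card_zmod _).symm
      _ = (Set.range (H.cyc i)).ncard := by
        rw [← Set.image_univ, Set.ncard_image_of_injective _ (H.cyc_pc i).1, Set.ncard_univ]
      _ ≤ W.ncard := Set.ncard_le_ncard hsub W.toFinite

lemma segment_induction {Q : ℕ → Prop} {a b : ℕ} (h : ∀ i, a ≤ i → i < b → (Q i ↔ Q (i + 1)))
    {i j : ℕ} (hai : a ≤ i) (hib : i ≤ b) (haj : a ≤ j) (hjb : j ≤ b) (hi : Q i) : Q j := by
  have key : ∀ m, a + m ≤ b → (Q a ↔ Q (a + m)) := by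
    intro m
    induction m with
    | zero => simp
    | succ m ih => exact fun hm => (ih (by omega)).trans (h (a + m) (by omega) (by omega))
  have h1 := key (i - a) (by omega)
  have h2 := key (j - a) (by omega)
  rw [Nat.add_sub_cancel' hai] at h1
  rw [Nat.add_sub_cancel' haj] at h2
  exact h2.1 (h1.2 hi)

/-- Adjacency, in terms of positions, in the graph obtained from the path `0, …, k - 1` by deleting
the edges `f, f + 1` and `g, g + 1` and adding the edges `0, x` and `k - 1, y` and `u, w`. -/
def RewiredAdj (k x y f g u w i j : ℕ) : Prop :=
  (j = i + 1 ∧ i ≠ f ∧ i ≠ g) ∨ (i = j + 1 ∧ j ≠ f ∧ j ≠ g) ∨ (i = 0 ∧ j = x) ∨ (j = 0 ∧ i = x) ∨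
    (i + 1 = k ∧ j = y) ∨ (j + 1 = k ∧ i = y) ∨ (i = u ∧ j = w) ∨ (j = u ∧ i = w)

/-- The edge `f, f + 1` has end `u`, with path-neighbor `u'` on the other side of `u`, and other
end `x`, with path-neighbor `x'` on the other side of `x`. -/
def IsLeftCut (k t x x' f u u' : ℕ) : Prop :=
  (x = u + 1 ∧ f = u ∧ u' + 1 = u ∧ x' = u + 2 ∧ 2 ≤ u ∧ u + 4 ≤ k) ∨
    (x + 1 = u ∧ f + 1 = u ∧ u' = u + 1 ∧ x' + 2 = u ∧ 4 ≤ u ∧ u + 2 ≤ k ∧ t ≤ u)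

/-- The mirror image of `IsLeftCut`. -/
def IsRightCut (k t y y' g w w' : ℕ) : Prop :=
  (y + 1 = w ∧ g + 1 = w ∧ w' = w + 1 ∧ y' + 2 = w ∧ 3 ≤ w ∧ w + 3 ≤ k) ∨
    (y = w + 1 ∧ g = w ∧ w' + 1 = w ∧ y' = w + 2 ∧ 1 ≤ w ∧ w + 5 ≤ k ∧ w + 1 + t ≤ k)

lemma RewiredAdj.symm {k x y f g u w i j : ℕ} (h : RewiredAdj k x y f g u w i j) :
    RewiredAdj k x y f g u w j i := by
  unfold RewiredAdj at h ⊢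
  tauto

lemma IsLeftCut.bounds {k t x x' f u u' : ℕ} (h : IsLeftCut k t x x' f u u') :
    2 ≤ f ∧ f + 2 < k ∧ 2 < x ∧ x + 2 < k := by
  unfold IsLeftCut at h
  omega

lemma IsRightCut.bounds {k t y y' g w w' : ℕ} (h : IsRightCut k t y y' g w w') :
    1 ≤ g ∧ g + 3 < k ∧ 1 < y ∧ y + 3 < k := by
  unfold IsRightCut at h
  omega

lemma card_of_closed_rewired {k t x x' f u u' y y' g w w' : ℕ} (ht : 3 ≤ t)
    (hL : IsLeftCut k t x x' f u u') (hR : IsRightCut k t y y' g w w')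
    (hu : u % 2 = 0) (hw : w % 2 = 1)
    (far₁ : u < w → u + t ≤ w + 1) (far₂ : w < u → w + t ≤ u + 1 ∧ u + t + 1 ≤ w + k)
    (W : Finset ℕ) (hWk : ∀ i ∈ W, i < k) (hne : W.Nonempty)
    (hW : ∀ i ∈ W, ∀ j < k, RewiredAdj k x y f g u w i j → j ∈ W) : t ≤ W.card := by
  have one : ∀ a b, (∀ i, a ≤ i → i ≤ b → i ∈ W) → a + t ≤ b + 1 → t ≤ W.card := by
    intro a b h hab
    have := Finset.card_le_card (s := Finset.Icc a b) (t := W)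
      (fun i hi => h i (Finset.mem_Icc.1 hi).1 (Finset.mem_Icc.1 hi).2)
    rw [Nat.card_Icc] at this
    omega
  have two : ∀ a b, (∀ i ≤ a, i ∈ W) → (∀ i, b ≤ i → i < k → i ∈ W) → a < b →
      t + b ≤ a + 1 + k → t ≤ W.card := by
    intro a b h1 h2 hab hk
    have := Finset.card_le_card (s := Finset.range (a + 1) ∪ Finset.Ico b k) (t := W) (by
      intro i hi
      rcases Finset.mem_union.1 hi with hi | hi
      · exact h1 i (by have := Finset.mem_range.1 hi; omega)
      · exact h2 i (Finset.mem_Ico.1 hi).1 (Finset.mem_Ico.1 hi).2)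
    rw [Finset.card_union_of_disjoint] at this
    · simp at this
      omega
    · rw [Finset.disjoint_left]
      intro i hi hi'
      have h3 := Finset.mem_range.1 hi
      have h4 := (Finset.mem_Ico.1 hi').1
      omega
  have hiff : ∀ i j, i < k → j < k → RewiredAdj k x y f g u w i j → (i ∈ W ↔ j ∈ W) := by
    intro i j hi hj h
    refine ⟨fun h' => hW i h' j hj h, fun h' => hW j h' i hi h.symm⟩
  have hstep : ∀ i, i + 1 < k → i ≠ f → i ≠ g → (i ∈ W ↔ i + 1 ∈ W) := fun i hi h1 h2 =>
    hiff i (i + 1) (by omega) hi (Or.inl ⟨rfl, h1, h2⟩)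
  have hseg : ∀ a b i j, (f < a ∨ b ≤ f) → (g < a ∨ b ≤ g) → b < k → i ∈ W → a ≤ i → i ≤ b →
      a ≤ j → j ≤ b → j ∈ W := by
    intro a b i j hf hg hb hi h1 h2 h3 h4
    exact segment_induction (Q := (· ∈ W)) (a := a) (b := b)
      (fun m hm1 hm2 => hstep m (by omega) (by omega) (by omega)) h1 h2 h3 h4 hi
  obtain ⟨bf, bfk, bx, bxk⟩ := hL.bounds
  obtain ⟨bg, bgk, bY, byk⟩ := hR.bounds
  have h0x : 0 ∈ W ↔ x ∈ W := hiff 0 x (by omega) (by omega) (by simp [RewiredAdj])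
  have hky : k - 1 ∈ W ↔ y ∈ W := hiff (k - 1) y (by omega) (by omega)
    (Or.inr (Or.inr (Or.inr (Or.inr (Or.inl ⟨by omega, rfl⟩)))))
  obtain ⟨i, hi⟩ := hne
  have hik := hWk i hi
  have hcases : (f < g ∧ u + t ≤ w + 1 ∧ f + t ≤ g + 2) ∨
      (g < f ∧ g + t ≤ f + 2 ∧ w + t ≤ u + 1 ∧ u + t + 1 ≤ w + k) := by
    rcases Nat.lt_or_gt_of_ne (show u ≠ w by omega) with h | h
    · have := far₁ h
      rcases hL with hL | hL <;> rcases hR with hR | hR <;> left <;> omega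
    · have := far₂ h
      rcases hL with hL | hL <;> rcases hR with hR | hR <;> right <;> omega
  clear far₁ far₂
  rcases hcases with ⟨hlt, hd, hd'⟩ | ⟨hlt, hd, hd', hd''⟩
  · have t1 : 0 ∈ W → t ≤ W.card := by
      intro h
      have s1 := hseg 0 f 0
      rcases hL with hL | hL
      · have s2 := hseg (f + 1) g x
        refine one 0 g (fun j _ hj => ?_) (by omega)
        by_cases hjf : j ≤ f
        · exact s1 j (by omega) (by omega) (by omega) h (by omega) (by omega) (by omega) hjf
        · exact s2 j (by omega) (by omega) (by omega) (h0x.1 h) (by omega) (by omega)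
            (by omega) hj
      · exact one 0 f (fun j _ hj => s1 j (by omega) (by omega) (by omega) h (by omega) (by omega)
          (by omega) hj) (by omega)
    have t3 : k - 1 ∈ W → t ≤ W.card := by
      intro h
      have s1 := hseg (g + 1) (k - 1) (k - 1)
      rcases hR with hR | hR
      · have s2 := hseg (f + 1) g y
        refine one (f + 1) (k - 1) (fun j hj1 hj2 => ?_) (by omega)
        by_cases hjf : g < j
        · exact s1 j (by omega) (by omega) (by omega) h (by omega) (by omega) (by omega) hj2
        · exact s2 j (by omega) (by omega) (by omega) (hky.1 h) (by omega) (by omega)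
            (by omega) (by omega)
      · exact one (g + 1) (k - 1) (fun j hj1 hj2 => s1 j (by omega) (by omega) (by omega) h
          (by omega) (by omega) hj1 hj2) (by omega)
    by_cases h1 : i ≤ f
    · exact t1 (hseg 0 f i 0 (by omega) (by omega) (by omega) hi (by omega) h1 (by omega)
        (by omega))
    by_cases h3 : g < i
    · exact t3 (hseg (g + 1) (k - 1) i (k - 1) (by omega) (by omega) (by omega) hi (by omega)
        (by omega) (by omega) (by omega))
    have s2 := hseg (f + 1) g i
    rcases hL with hL | hL
    · exact t1 (h0x.2 (s2 x (by omega) (by omega) (by omega) hi (by omega) (by omega) (by omega)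
        (by omega)))
    rcases hR with hR | hR
    · exact t3 (hky.2 (s2 y (by omega) (by omega) (by omega) hi (by omega) (by omega) (by omega)
        (by omega)))
    exact one (f + 1) g (fun j hj1 hj2 => s2 j (by omega) (by omega) (by omega) hi (by omega)
      (by omega) hj1 hj2) (by omega)
  · have t2 : ∀ i ∈ W, g < i → i ≤ f → t ≤ W.card := by
      intro i hi hi1 hi2
      have s2 := hseg (g + 1) f i
      rcases hL with hL | hL
      · rcases hR with hR | hR
        · exact one (g + 1) f (fun j hj1 hj2 => s2 j (by omega) (by omega) (by omega) hi
            (by omega) (by omega) hj1 hj2) (by omega)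
        · have hy := s2 y (by omega) (by omega) (by omega) hi (by omega) (by omega) (by omega)
            (by omega)
          have s3 := hseg (f + 1) (k - 1) (k - 1)
          refine one (g + 1) (k - 1) (fun j hj1 hj2 => ?_) (by omega)
          by_cases hjf : f < j
          · exact s3 j (by omega) (by omega) (by omega) (hky.2 hy) (by omega) (by omega) (by omega)
              hj2
          · exact s2 j (by omega) (by omega) (by omega) hi (by omega) (by omega) (by omega)
              (by omega)
      · have hx := s2 x (by omega) (by omega) (by omega) hi (by omega) (by omega) (by omega)
            (by omega)
        have s1 := hseg 0 g 0
        refine one 0 f (fun j hj1 hj2 => ?_) (by omega)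
        by_cases hjf : g < j
        · exact s2 j (by omega) (by omega) (by omega) hi (by omega) (by omega) (by omega)
            (by omega)
        · exact s1 j (by omega) (by omega) (by omega) (h0x.2 hx) (by omega) (by omega) (by omega)
            (by omega)
    have hends : 0 ∈ W → k - 1 ∈ W → t ≤ W.card := by
      intro h1 h3
      rcases hL with hL | hL
      · rcases hR with hR | hR
        · exact two g (f + 1)
            (fun j hj => hseg 0 g 0 j (by omega) (by omega) (by omega) h1 (by omega) (by omega)
              (by omega) hj)
            (fun j hj1 hj2 => hseg (f + 1) (k - 1) (k - 1) j (by omega) (by omega) (by omega) h3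
              (by omega) (by omega) hj1 (by omega)) (by omega) (by omega)
        · exact t2 y (hky.1 h3) (by omega) (by omega)
      · exact t2 x (h0x.1 h1) (by omega) (by omega)
    by_cases h1 : i ≤ g
    · have h0 : 0 ∈ W := hseg 0 g i 0 (by omega) (by omega) (by omega) hi (by omega) h1 (by omega)
        (by omega)
      rcases hL with hL | hL
      · exact hends h0 (hseg (f + 1) (k - 1) x (k - 1) (by omega) (by omega) (by omega) (h0x.1 h0)
          (by omega) (by omega) (by omega) (by omega))
      · exact t2 x (h0x.1 h0) (by omega) (by omega)
    by_cases h3 : f < i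
    · have hk : k - 1 ∈ W := hseg (f + 1) (k - 1) i (k - 1) (by omega) (by omega) (by omega) hi
        (by omega) (by omega) (by omega) (by omega)
      rcases hR with hR | hR
      · exact hends (hseg 0 g y 0 (by omega) (by omega) (by omega) (hky.1 hk)
          (by omega) (by omega) (by omega) (by omega)) hk
      · exact t2 y (hky.1 hk) (by omega) (by omega)
    exact t2 i hi (by omega) (by omega)

lemma rewired_neighbors {k t x x' f u u' y y' g w w' : ℕ} (hk : k % 2 = 0)
    (hL : IsLeftCut k t x x' f u u') (hR : IsRightCut k t y y' g w w')
    (hu : u % 2 = 0) (hw : w % 2 = 1) (hfar : u + 2 < w ∨ w + 2 < u) :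
    (∀ j < k, RewiredAdj k x y f g u w 0 j ↔ j = x ∨ j = 1) ∧
    (∀ j < k, RewiredAdj k x y f g u w (k - 1) j ↔ j = y ∨ j = k - 2) ∧
    (∀ j < k, RewiredAdj k x y f g u w x j ↔ j = 0 ∨ j = x') ∧
    (∀ j < k, RewiredAdj k x y f g u w y j ↔ j = k - 1 ∨ j = y') ∧
    (∀ j < k, RewiredAdj k x y f g u w u j ↔ j = w ∨ j = u') ∧
    (∀ j < k, RewiredAdj k x y f g u w w j ↔ j = u ∨ j = w') ∧
    (∀ i < k, i ≠ 0 → i ≠ k - 1 → i ≠ x → i ≠ y → i ≠ u → i ≠ w →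
      ∀ j < k, RewiredAdj k x y f g u w i j ↔ j = i - 1 ∨ j = i + 1) := by
  have key : ∀ i r s, (∀ j < k, RewiredAdj k x y f g u w i j → j ≠ r → j = s) →
      RewiredAdj k x y f g u w i r → RewiredAdj k x y f g u w i s →
      ∀ j < k, RewiredAdj k x y f g u w i j ↔ j = r ∨ j = s := by
    intro i r s h h1 h2 j hj
    refine ⟨fun hA => or_iff_not_imp_left.2 (h j hj hA), ?_⟩
    rintro (rfl | rfl)
    · exact h1
    · exact h2
  rcases hfar with hfar | hfar <;>
  rcases hL with ⟨rfl, rfl, h1, rfl, h2, h3⟩ | ⟨h1, h2, rfl, h3, h4, h5, -⟩ <;>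
  rcases hR with ⟨h6, h7, rfl, h8, h9, h10⟩ | ⟨rfl, rfl, h6, rfl, h7, h8, -⟩ <;>
  refine ⟨key _ _ _ ?_ ?_ ?_, key _ _ _ ?_ ?_ ?_, key _ _ _ ?_ ?_ ?_, key _ _ _ ?_ ?_ ?_,
    key _ _ _ ?_ ?_ ?_, key _ _ _ ?_ ?_ ?_, fun i hi i1 i2 i3 i4 i5 i6 => key _ _ _ ?_ ?_ ?_⟩ <;>
  first
  | (rintro j hj (h | h | h | h | h | h | h | h) hne <;> omega)
  | (refine Or.inl ⟨?_, ?_, ?_⟩ <;> omega)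
  | (refine Or.inr (Or.inl ⟨?_, ?_, ?_⟩) <;> omega)
  | (refine Or.inr (Or.inr (Or.inl ⟨?_, ?_⟩)) <;> omega)
  | (refine Or.inr (Or.inr (Or.inr (Or.inl ⟨?_, ?_⟩))) <;> omega)
  | (refine Or.inr (Or.inr (Or.inr (Or.inr (Or.inl ⟨?_, ?_⟩)))) <;> omega)
  | (refine Or.inr (Or.inr (Or.inr (Or.inr (Or.inr (Or.inl ⟨?_, ?_⟩))))) <;> omega)
  | (refine Or.inr (Or.inr (Or.inr (Or.inr (Or.inr (Or.inr (Or.inl ⟨?_, ?_⟩)))))) <;> omega)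
  | (refine Or.inr (Or.inr (Or.inr (Or.inr (Or.inr (Or.inr (Or.inr ⟨?_, ?_⟩)))))) <;> omega)

lemma exists_factor_path (hsym : ∀ u v, c u v = c v u) {k t x x' f u u' y y' g w w' : ℕ}
    {p : ℕ → V2 n} (hp : IsPCSeq n c k p) (ht : 3 ≤ t) (hk : k % 2 = 0)
    (hL : IsLeftCut k t x x' f u u') (hR : IsRightCut k t y y' g w w')
    (hu : u % 2 = 0) (hw : w % 2 = 1)
    (far₁ : u < w → u + t ≤ w + 1) (far₂ : w < u → w + t ≤ u + 1 ∧ u + t + 1 ≤ w + k)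
    (c₀ : c (p 0) (p x) ≠ c (p 0) (p 1)) (cx : c (p 0) (p x) ≠ c (p x) (p x'))
    (ck : c (p (k - 1)) (p y) ≠ c (p (k - 1)) (p (k - 2)))
    (cy : c (p (k - 1)) (p y) ≠ c (p y) (p y'))
    (cu : c (p u) (p w) ≠ c (p u) (p u')) (cw : c (p u) (p w) ≠ c (p w) (p w')) :
    ∃ F, IsFactorOn n c {v | ∃ i < k, p i = v} F t := by
  have hcard := card_of_closed_rewired ht hL hR hu hw far₁ far₂
  have hodd : ∀ i j, i < k → j < k → RewiredAdj k x y f g u w i j → ¬ Even (i + j) := by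
    intro i j hi hj h
    rw [Nat.even_iff]
    unfold RewiredAdj at h
    clear far₁ far₂
    rcases hL with hL | hL <;> rcases hR with hR | hR <;> omega
  let F : SimpleGraph (V2 n) :=
    { Adj := fun a b => ∃ i j, i < k ∧ j < k ∧ RewiredAdj k x y f g u w i j ∧ p i = a ∧ p j = b
      symm := by
        constructor
        rintro a b ⟨i, j, hi, hj, h, rfl, rfl⟩
        exact ⟨j, i, hj, hi, h.symm, rfl, rfl⟩
      loopless := by
        constructor
        rintro a ⟨i, j, hi, hj, h, rfl, hij⟩
        rw [hp.inj j hj i hi hij] at h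
        exact hodd i i hi hi h ⟨i, rfl⟩ }
  have hF : ∀ i < k, ∀ b, F.Adj (p i) b ↔ ∃ j < k, RewiredAdj k x y f g u w i j ∧ p j = b := by
    intro i hi b
    constructor
    · rintro ⟨i', j, hi', hj, h, hii', rfl⟩
      rw [hp.inj i' hi' i hi hii'] at h
      exact ⟨j, hj, h, rfl⟩
    · rintro ⟨j, hj, h, rfl⟩
      exact ⟨i, j, hi, hj, h, rfl, rfl⟩
  have htwo : ∀ i < k, ∃ r s, r < k ∧ s < k ∧ c (p i) (p r) ≠ c (p i) (p s) ∧
      ∀ j < k, RewiredAdj k x y f g u w i j ↔ j = r ∨ j = s := by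
    intro i hi
    have hfar : u + 2 < w ∨ w + 2 < u := by omega
    obtain ⟨bf, bfk, bx, bxk⟩ := hL.bounds
    obtain ⟨bg, bgk, bY, byk⟩ := hR.bounds
    obtain ⟨h0, hk1, hx, hy, hu, hw, hgen⟩ := rewired_neighbors hk hL hR hu hw hfar
    obtain ⟨buk, bwk, bu', bw', bx', by'⟩ : u < k ∧ w < k ∧ u' < k ∧ w' < k ∧ x' < k ∧ y' < k := by
      rcases hL with hL | hL <;> rcases hR with hR | hR <;> omega
    clear far₁ far₂ hfar
    by_cases i0 : i = 0
    · subst i0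
      exact ⟨x, 1, by omega, by omega, c₀, h0⟩
    by_cases ik1 : i = k - 1
    · subst ik1
      exact ⟨y, k - 2, by omega, by omega, ck, hk1⟩
    by_cases ix : i = x
    · subst ix
      exact ⟨0, x', by omega, bx', by rwa [hsym (p i)], hx⟩
    by_cases iy : i = y
    · subst iy
      exact ⟨k - 1, y', by omega, by', by rwa [hsym (p i)], hy⟩
    by_cases iu : i = u
    · subst iu
      exact ⟨w, u', bwk, bu', cu, hu⟩
    by_cases iw : i = w
    · subst iw
      exact ⟨u, w', buk, bw', by rwa [hsym (p i)], hw⟩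
    refine ⟨i - 1, i + 1, by omega, by omega, ?_, hgen i hi i0 ik1 ix iy iu iw⟩
    have := hp.pc (i - 1) (by omega)
    rwa [show i - 1 + 1 = i by omega, show i - 1 + 2 = i + 1 by omega, hsym] at this
  refine ⟨F, ?_, ?_, ?_, ?_⟩
  · rintro a b ⟨i, j, hi, hj, h, rfl, rfl⟩
    exact (hp.adj_iff hi hj).2 (hodd i j hi hj h)
  · rintro a b ⟨i, j, hi, hj, h, rfl, rfl⟩
    exact ⟨i, hi, rfl⟩
  · rintro a ⟨i, hi, rfl⟩
    obtain ⟨r, s, hr, hs, hc, h⟩ := htwo i hi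
    refine ⟨p r, p s, hc, fun b => ?_⟩
    rw [hF i hi]
    constructor
    · rintro ⟨j, hj, hE, rfl⟩
      rcases (h j hj).1 hE with rfl | rfl <;> simp
    · rintro (rfl | rfl)
      · exact ⟨r, hr, (h r hr).2 (Or.inl rfl), rfl⟩
      · exact ⟨s, hs, (h s hs).2 (Or.inr rfl), rfl⟩
  · rintro W hWS ⟨a, ha⟩ hW
    classical
    let W' := (Finset.range k).filter fun i => p i ∈ W
    have hmem : ∀ i, i ∈ W' ↔ i < k ∧ p i ∈ W := by simp [W']
    obtain ⟨i, hi, rfl⟩ := hWS ha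
    have h1 := hcard W' (fun i hi => ((hmem i).1 hi).1) ⟨i, (hmem i).2 ⟨hi, ha⟩⟩
      (fun i hi j hj h => (hmem j).2 ⟨hj, hW _ ((hmem i).1 hi).2 _
        ((hF i ((hmem i).1 hi).1 _).2 ⟨j, hj, h, rfl⟩)⟩)
    refine h1.trans ?_
    rw [← Set.ncard_coe_finset]
    refine Set.ncard_le_ncard_of_injOn p (fun i hi => ((hmem i).1 hi).2) ?_ W.toFinite
    exact fun i hi j hj => hp.inj i ((hmem i).1 hi).1 j ((hmem j).1 hj).1

lemma card_eq_card_image_fst_add (W : Finset (ℕ × Bool)) :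
    W.card = (W.image Prod.fst).card +
      ((W.image Prod.fst).filter fun u => (u, true) ∈ W ∧ (u, false) ∈ W).card := by
  have inj : ∀ b, Set.InjOn Prod.fst ((W.filter fun x => x.2 = b : Finset (ℕ × Bool)) :
      Set (ℕ × Bool)) := by
    rintro b ⟨x, a⟩ hx ⟨y, a'⟩ hy h
    simp only [Finset.coe_filter, Set.mem_ofPred_eq] at hx hy
    simp_all
  have h1 := Finset.card_union_add_card_inter ((W.filter fun x => x.2 = true).image Prod.fst)
    ((W.filter fun x => x.2 = false).image Prod.fst)
  rw [Finset.card_image_of_injOn (inj true), Finset.card_image_of_injOn (inj false)] at h1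
  have h2 := Finset.card_filter_add_card_filter_not (s := W) (fun x => x.2 = true)
  simp only [Bool.not_eq_true] at h2
  rw [← h2, ← h1]
  congr 2
  · ext u
    simp only [Finset.mem_union, Finset.mem_image, Finset.mem_filter, Prod.exists, Bool.exists_bool]
    grind
  · ext u
    simp only [Finset.mem_inter, Finset.mem_image, Finset.mem_filter, Prod.exists, Bool.exists_bool]
    grind

lemma mem_true_and_mem_false {W : Finset (ℕ × Bool)} {u : ℕ} {b b' : Bool} (hb : (u, b) ∈ W)
    (hb' : (u, b') ∈ W) (hne : b ≠ b') : (u, true) ∈ W ∧ (u, false) ∈ W := by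
  cases b <;> cases b' <;> simp_all

lemma false_of_card_bounds {q h M σ τ s₁ t₁ z y N : ℕ} (hh : 1 ≤ h) (hM : 2 * q + 5 * h ≤ M)
    (total : σ * τ ≤ s₁ * q + t₁ * q + N) (dS : s₁ + z = σ) (dT : t₁ + y = τ)
    (eS : M = σ + z) (eT : M = τ + y) (cN₁ : N ≤ σ * (2 * h)) (cN₂ : N ≤ τ * (2 * h))
    (bS : 1 ≤ z → y ≤ 2 * h) (bT : 1 ≤ y → z ≤ 2 * h) (zS : z ≤ σ) (zT : y ≤ τ) : False := by
  obtain ⟨d, hMd⟩ : ∃ d, M = 2 * q + 2 * h + d := ⟨M - (2 * q + 2 * h), by omega⟩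
  have hd : 3 * h ≤ d := by omega
  have main : M * d + z * y ≤ (z + y) * (d + h) := by
    subst dS dT
    zify at *
    have h1 : (s₁ : ℤ) = M - 2 * z := by linarith
    have h2 : (t₁ : ℤ) = M - 2 * y := by linarith
    rw [h1, h2] at total
    rw [h1] at cN₁
    rw [h2] at cN₂
    rw [hMd] at total cN₁ cN₂ ⊢
    linarith
  have small : ∀ z : ℕ, 2 * z ≤ M → M * d ≤ z * (d + h) → False := by
    intro z hz h1
    have h2 : 2 * (M * d) ≤ M * (d + h) := by nlinarith
    have h3 : 0 < M * h := Nat.mul_pos (by omega) hh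
    nlinarith
  rcases Nat.eq_zero_or_pos y with rfl | hy
  · exact small z (by omega) (by simpa using main)
  rcases Nat.eq_zero_or_pos z with rfl | hz
  · exact small y (by omega) (by simpa using main)
  have hy' := bS hz
  have hz' := bT hy
  zify at *
  have h1 : ((d : ℤ) - h) * (d - h) ≤ (d + h - z) * (d + h - y) :=
    mul_le_mul (by linarith) (by linarith) (by linarith) (by linarith)
  have h2 : 0 < (d : ℤ) * (M - 4 * h) := mul_pos (by linarith) (by linarith)
  nlinarith

/-- An incompatibility bound: `S` and `T` are sets of ends, each with at most two colors attached
to it. If the color of every pair of ends that are not near is attached to one of the two ends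
in each choice of attached colors, then there are few ends. -/
lemma card_ways_lt {q h M : ℕ} {S T : Finset (ℕ × Bool)} {C : ℕ → ℕ → ℕ} {colS colT : ℕ × Bool → ℕ}
    {near : ℕ → ℕ → Prop} (hh : 1 ≤ h) (hM : 2 * q + 5 * h ≤ M)
    (hS : ∀ u, (u, true) ∈ S → (u, false) ∈ S → colS (u, true) ≠ colS (u, false))
    (hT : ∀ u, (u, true) ∈ T → (u, false) ∈ T → colT (u, true) ≠ colT (u, false))
    (fact : ∀ a ∈ S, ∀ b ∈ T, ¬ near a.1 b.1 → C a.1 b.1 = colS a ∨ C a.1 b.1 = colT b)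
    (qS : ∀ a ∈ S, ∀ A : Finset ℕ, A ⊆ T.image Prod.fst → (∀ v ∈ A, C a.1 v = colS a) → A.card ≤ q)
    (qT : ∀ b ∈ T, ∀ A : Finset ℕ, A ⊆ S.image Prod.fst → (∀ u ∈ A, C u b.1 = colT b) → A.card ≤ q)
    (nS : ∀ a ∈ S, ∀ A : Finset ℕ, A ⊆ T.image Prod.fst → (∀ v ∈ A, near a.1 v) → A.card ≤ 2 * h)
    (nT : ∀ b ∈ T, ∀ A : Finset ℕ, A ⊆ S.image Prod.fst → (∀ u ∈ A, near u b.1) → A.card ≤ 2 * h)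
    (cS : S.card = M) (cT : T.card = M) : False := by
  classical
  have eS := card_eq_card_image_fst_add S
  have eT := card_eq_card_image_fst_add T
  set S₀ := S.image Prod.fst with hS₀
  set T₀ := T.image Prod.fst with hT₀
  set S₂ := S₀.filter fun u => (u, true) ∈ S ∧ (u, false) ∈ S with hS₂
  set T₂ := T₀.filter fun u => (u, true) ∈ T ∧ (u, false) ∈ T with hT₂
  have exS : ∀ u ∈ S₀, ∃ b, (u, b) ∈ S := by simp [hS₀]
  have exT : ∀ u ∈ T₀, ∃ b, (u, b) ∈ T := by simp [hT₀]
  have avoidS : ∀ u ∈ S₂, ∀ κ, ∃ b, (u, b) ∈ S ∧ κ ≠ colS (u, b) := by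
    intro u hu κ
    obtain ⟨-, h1, h2⟩ := Finset.mem_filter.1 hu
    by_cases h : κ = colS (u, true)
    · exact ⟨false, h2, h ▸ hS u h1 h2⟩
    · exact ⟨true, h1, h⟩
  have avoidT : ∀ u ∈ T₂, ∀ κ, ∃ b, (u, b) ∈ T ∧ κ ≠ colT (u, b) := by
    intro u hu κ
    obtain ⟨-, h1, h2⟩ := Finset.mem_filter.1 hu
    by_cases h : κ = colT (u, true)
    · exact ⟨false, h2, h ▸ hT u h1 h2⟩
    · exact ⟨true, h1, h⟩
  have both : ∀ u ∈ S₂, ∀ v ∈ T₂, near u v := by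
    intro u hu v hv
    by_contra hn
    obtain ⟨b, hb, h1⟩ := avoidS u hu (C u v)
    obtain ⟨b', hb', h2⟩ := avoidT v hv (C u v)
    exact (fact _ hb _ hb' hn).elim h1 h2
  have zS : S₂.card ≤ S₀.card := Finset.card_filter_le _ _
  have zT : T₂.card ≤ T₀.card := Finset.card_filter_le _ _
  have bS : 1 ≤ S₂.card → T₂.card ≤ 2 * h := by
    intro h0
    obtain ⟨u, hu⟩ := Finset.card_pos.1 h0
    obtain ⟨b, hb⟩ := exS u (Finset.mem_filter.1 hu).1
    exact nS _ hb T₂ (Finset.filter_subset _ _) (fun v hv => both u hu v hv)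
  have bT : 1 ≤ T₂.card → S₂.card ≤ 2 * h := by
    intro h0
    obtain ⟨v, hv⟩ := Finset.card_pos.1 h0
    obtain ⟨b, hb⟩ := exT v (Finset.mem_filter.1 hv).1
    exact nT _ hb S₂ (Finset.filter_subset _ _) (fun u hu => both u hu v hv)
  choose! β hβ using exS
  choose! γ hγ using exT
  have uS : ∀ u ∈ S₀ \ S₂, ∀ b, (u, b) ∈ S → b = β u := by
    intro u hu b hb
    obtain ⟨hu0, hu2⟩ := Finset.mem_sdiff.1 hu
    have h1 := hβ u hu0
    by_contra hne
    exact hu2 (Finset.mem_filter.2 ⟨hu0, mem_true_and_mem_false hb h1 hne⟩)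
  have uT : ∀ u ∈ T₀ \ T₂, ∀ b, (u, b) ∈ T → b = γ u := by
    intro u hu b hb
    obtain ⟨hu0, hu2⟩ := Finset.mem_sdiff.1 hu
    have h1 := hγ u hu0
    by_contra hne
    exact hu2 (Finset.mem_filter.2 ⟨hu0, mem_true_and_mem_false hb h1 hne⟩)
  let E₁ := (S₀ \ S₂).sigma fun u => T₀.filter fun v => C u v = colS (u, β u)
  let E₂ := (T₀ \ T₂).sigma fun v => S₀.filter fun u => C u v = colT (v, γ v)
  let N := (S₀ ×ˢ T₀).filter fun x => near x.1 x.2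
  have cE₁ : E₁.card ≤ (S₀ \ S₂).card * q := by
    rw [Finset.card_sigma]
    refine (Finset.sum_le_card_nsmul _ _ q fun u hu => ?_).trans (by simp)
    exact qS _ (hβ u (Finset.mem_sdiff.1 hu).1) _ (Finset.filter_subset _ _)
      (fun v hv => (Finset.mem_filter.1 hv).2)
  have cE₂ : E₂.card ≤ (T₀ \ T₂).card * q := by
    rw [Finset.card_sigma]
    refine (Finset.sum_le_card_nsmul _ _ q fun u hu => ?_).trans (by simp)
    exact qT _ (hγ u (Finset.mem_sdiff.1 hu).1) _ (Finset.filter_subset _ _)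
      (fun v hv => (Finset.mem_filter.1 hv).2)
  have cN₁ : N.card ≤ S₀.card * (2 * h) := by
    have : N.card ≤ (S₀.sigma fun u => T₀.filter fun v => near u v).card := by
      refine Finset.card_le_card_of_injOn (fun x => ⟨x.1, x.2⟩) ?_ ?_
      · intro x hx
        simp only [N, Finset.coe_filter, Finset.mem_product, Set.mem_ofPred_eq] at hx
        simp [hx]
      · rintro ⟨a, b⟩ - ⟨a', b'⟩ - h
        simpa using h
    refine this.trans ?_
    rw [Finset.card_sigma]
    refine (Finset.sum_le_card_nsmul _ _ (2 * h) fun u hu => ?_).trans (by simp)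
    exact nS _ (hβ u hu) _ (Finset.filter_subset _ _) (fun v hv => (Finset.mem_filter.1 hv).2)
  have cN₂ : N.card ≤ T₀.card * (2 * h) := by
    have : N.card ≤ (T₀.sigma fun v => S₀.filter fun u => near u v).card := by
      refine Finset.card_le_card_of_injOn (fun x => ⟨x.2, x.1⟩) ?_ ?_
      · intro x hx
        simp only [N, Finset.coe_filter, Finset.mem_product, Set.mem_ofPred_eq] at hx
        simp [hx]
      · rintro ⟨a, b⟩ - ⟨a', b'⟩ - h
        simp at h
        simp [h]
    refine this.trans ?_
    rw [Finset.card_sigma]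
    refine (Finset.sum_le_card_nsmul _ _ (2 * h) fun u hu => ?_).trans (by simp)
    exact nT _ (hγ u hu) _ (Finset.filter_subset _ _) (fun v hv => (Finset.mem_filter.1 hv).2)
  have cover : S₀ ×ˢ T₀ ⊆ E₁.image (fun x => (x.1, x.2)) ∪ E₂.image (fun x => (x.2, x.1)) ∪ N := by
    rintro ⟨u, v⟩ huv
    obtain ⟨hu, hv⟩ := Finset.mem_product.1 huv
    by_cases hn : near u v
    · exact Finset.mem_union_right _ (Finset.mem_filter.2 ⟨huv, hn⟩)
    refine Finset.mem_union_left _ (Finset.mem_union.2 ?_)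
    have left : (u ∈ S₀ \ S₂ ∧ C u v = colS (u, β u)) → (u, v) ∈ E₁.image (fun x => (x.1, x.2)) :=
      fun h => Finset.mem_image.2 ⟨⟨u, v⟩, by
        simp only [E₁, Finset.mem_sigma, Finset.mem_filter]; exact ⟨h.1, hv, h.2⟩, rfl⟩
    have right : (v ∈ T₀ \ T₂ ∧ C u v = colT (v, γ v)) → (u, v) ∈ E₂.image (fun x => (x.2, x.1)) :=
      fun h => Finset.mem_image.2 ⟨⟨v, u⟩, by
        simp only [E₂, Finset.mem_sigma, Finset.mem_filter]; exact ⟨h.1, hu, h.2⟩, rfl⟩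
    by_cases hu2 : u ∈ S₂
    · have hv2 : v ∉ T₂ := fun hv2 => hn (both u hu2 v hv2)
      obtain ⟨b, hb, h1⟩ := avoidS u hu2 (C u v)
      exact Or.inr (right ⟨Finset.mem_sdiff.2 ⟨hv, hv2⟩,
        (fact _ hb _ (hγ v hv) hn).resolve_left h1⟩)
    by_cases hv2 : v ∈ T₂
    · obtain ⟨b, hb, h1⟩ := avoidT v hv2 (C u v)
      exact Or.inl (left ⟨Finset.mem_sdiff.2 ⟨hu, hu2⟩,
        (fact _ (hβ u hu) _ hb hn).resolve_right h1⟩)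
    rcases fact _ (hβ u hu) _ (hγ v hv) hn with h | h
    · exact Or.inl (left ⟨Finset.mem_sdiff.2 ⟨hu, hu2⟩, h⟩)
    · exact Or.inr (right ⟨Finset.mem_sdiff.2 ⟨hv, hv2⟩, h⟩)
  have total := Finset.card_le_card cover
  rw [Finset.card_product] at total
  have total' : S₀.card * T₀.card ≤ (S₀ \ S₂).card * q + (T₀ \ T₂).card * q + N.card := by
    refine total.trans ((Finset.card_union_le _ _).trans (Nat.add_le_add_right ?_ _))
    refine (Finset.card_union_le _ _).trans (Nat.add_le_add ?_ ?_)
    · exact Finset.card_image_le.trans cE₁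
    · exact Finset.card_image_le.trans cE₂
  have dS := Finset.card_sdiff_add_card_eq_card (s := S₂) (t := S₀) (Finset.filter_subset _ _)
  have dT := Finset.card_sdiff_add_card_eq_card (s := T₂) (t := T₀) (Finset.filter_subset _ _)
  rw [cS] at eS
  rw [cT] at eT
  exact false_of_card_bounds hh hM total' dS dT eS eT cN₁ cN₂ bS bT zS zT

/-- `IsWay n c k t p u b` says that the beginning of the path `p` can be rerouted so that `p u`
becomes an end: `p 0` is joined to the successor of `p u` if `b` is true, and to its predecessor
otherwise. -/
def IsWay (n : ℕ) (c : V2 n → V2 n → ℕ) (k t : ℕ) (p : ℕ → V2 n) (u : ℕ) : Bool → Prop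
  | true => u % 2 = 0 ∧ 2 ≤ u ∧ u + 4 ≤ k ∧ c (p 0) (p (u + 1)) ≠ c (p 0) (p 1) ∧
      c (p 0) (p (u + 1)) ≠ c (p (u + 1)) (p (u + 2))
  | false => u % 2 = 0 ∧ 4 ≤ u ∧ u + 2 ≤ k ∧ t ≤ u ∧ c (p 0) (p (u - 1)) ≠ c (p 0) (p 1) ∧
      c (p 0) (p (u - 1)) ≠ c (p (u - 1)) (p (u - 2))

/-- The color of the path edge that remains at the new end. -/
def wayColor (c : V2 n → V2 n → ℕ) (p : ℕ → V2 n) : ℕ × Bool → ℕ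
  | (u, true) => c (p u) (p (u - 1))
  | (u, false) => c (p u) (p (u + 1))

/-- The position `k - 1 - v` is at distance less than `t - 1` from `u`, cyclically. -/
def IsNear (k t u v : ℕ) : Prop :=
  (k + 1 ≤ u + v + t ∧ u + v + 3 ≤ k + t) ∨ 2 * k ≤ u + v + t + 1

lemma IsWay.bounds {k t : ℕ} {p : ℕ → V2 n} {u : ℕ} {b : Bool} (h : IsWay n c k t p u b) :
    u % 2 = 0 ∧ 2 ≤ u ∧ u + 2 ≤ k := by
  cases b
  · obtain ⟨h1, h2, h3, -⟩ := h
    omega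
  · obtain ⟨h1, h2, h3, -⟩ := h
    omega

lemma IsWay.exists_isLeftCut {k t : ℕ} {p : ℕ → V2 n} {u : ℕ} {b : Bool}
    (h : IsWay n c k t p u b) : ∃ x x' f u', IsLeftCut k t x x' f u u' ∧
      c (p 0) (p x) ≠ c (p 0) (p 1) ∧ c (p 0) (p x) ≠ c (p x) (p x') ∧
      wayColor c p (u, b) = c (p u) (p u') := by
  cases b
  · obtain ⟨h1, h2, h3, h4, h5, h6⟩ := h
    exact ⟨u - 1, u - 2, u - 1, u + 1, by unfold IsLeftCut; omega, h5, h6, rfl⟩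
  · obtain ⟨h1, h2, h3, h5, h6⟩ := h
    exact ⟨u + 1, u + 2, u, u - 1, by unfold IsLeftCut; omega, h5, h6, rfl⟩

lemma IsWay.exists_isRightCut {k t : ℕ} {p : ℕ → V2 n} {v : ℕ} {b : Bool}
    (h : IsWay n c k t (fun i => p (k - 1 - i)) v b) : ∃ y y' g w',
      IsRightCut k t y y' g (k - 1 - v) w' ∧ c (p (k - 1)) (p y) ≠ c (p (k - 1)) (p (k - 2)) ∧
      c (p (k - 1)) (p y) ≠ c (p y) (p y') ∧
      wayColor c (fun i => p (k - 1 - i)) (v, b) = c (p (k - 1 - v)) (p w') := by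
  cases b
  · obtain ⟨h1, h2, h3, h4, h5, h6⟩ := h
    exact ⟨k - 1 - (v - 1), k - 1 - (v - 2), k - 1 - v, k - 1 - (v + 1),
      by unfold IsRightCut; omega, h5, h6, rfl⟩
  · obtain ⟨h1, h2, h3, h5, h6⟩ := h
    exact ⟨k - 1 - (v + 1), k - 1 - (v + 2), k - 1 - (v + 1), k - 1 - (v - 1),
      by unfold IsRightCut; omega, h5, h6, rfl⟩

lemma IsWay.exists_factor (hsym : ∀ u v, c u v = c v u) {k t : ℕ} {p : ℕ → V2 n}
    (hp : IsPCSeq n c k p) (ht : 3 ≤ t) (hk : k % 2 = 0) {u v : ℕ} {b b' : Bool}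
    (hu : IsWay n c k t p u b) (hv : IsWay n c k t (fun i => p (k - 1 - i)) v b')
    (hn : ¬ IsNear k t u v) (h₁ : c (p u) (p (k - 1 - v)) ≠ wayColor c p (u, b))
    (h₂ : c (p u) (p (k - 1 - v)) ≠ wayColor c (fun i => p (k - 1 - i)) (v, b')) :
    ∃ F, IsFactorOn n c {v | ∃ i < k, p i = v} F t := by
  have hu' := hu.bounds
  have hv' := hv.bounds
  obtain ⟨x, x', f, u', hL, c₀, cx, hcu⟩ := hu.exists_isLeftCut
  obtain ⟨y, y', g, w', hR, ck, cy, hcw⟩ := hv.exists_isRightCut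
  rw [hcu] at h₁
  rw [hcw] at h₂
  unfold IsNear at hn
  exact exists_factor_path hsym hp ht hk hL hR hu'.1 (by omega) (by omega) (by omega)
    c₀ cx ck cy h₁ h₂

lemma card_isNear_le {k t u : ℕ} (hk : k % 2 = 0) (hu : u % 2 = 0 ∧ 2 ≤ u ∧ u + 2 ≤ k)
    (A : Finset ℕ) (hA : ∀ v ∈ A, (v % 2 = 0 ∧ 2 ≤ v ∧ v + 2 ≤ k) ∧ IsNear k t u v) :
    A.card ≤ 2 * ((t - 1) / 2) := by
  have hsub : A ⊆ (Finset.range ((t - 1) / 2)).image (fun j => k + 2 * j - u) ∪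
      (Finset.range ((t - 1) / 2)).image
        (fun j => if u + 4 + 2 * j ≤ k then k - 2 - u - 2 * j else 2 * k - 4 - u - 2 * j) := by
    intro v hv
    obtain ⟨hv, hn⟩ := hA v hv
    simp only [Finset.mem_union, Finset.mem_image, Finset.mem_range]
    by_cases h1 : k ≤ u + v ∧ u + v + 3 ≤ k + t
    · exact Or.inl ⟨(u + v - k) / 2, by omega, by omega⟩
    right
    by_cases h2 : u + v < k
    · refine ⟨(k - 2 - u - v) / 2, ?_, ?_⟩
      · unfold IsNear at hn; omega
      · rw [if_pos] <;> omega
    · refine ⟨(2 * k - 4 - u - v) / 2, ?_, ?_⟩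
      · unfold IsNear at hn; omega
      · rw [if_neg] <;> omega
  refine (Finset.card_le_card hsub).trans ((Finset.card_union_le _ _).trans ?_)
  have h1 := Finset.card_image_le (s := Finset.range ((t - 1) / 2)) (f := fun j => k + 2 * j - u)
  have h2 := Finset.card_image_le (s := Finset.range ((t - 1) / 2))
    (f := fun j => if u + 4 + 2 * j ≤ k then k - 2 - u - 2 * j else 2 * k - 4 - u - 2 * j)
  rw [Finset.card_range] at h1 h2
  omega

lemma IsPCSeq.card_add_colorDeg_le {k : ℕ} {p : ℕ → V2 n} (hp : IsPCSeq n c k p) {i : ℕ}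
    (hi : i < k) (κ : ℕ) (A : Finset ℕ)
    (hA : ∀ j ∈ A, j < k ∧ ¬ Even (i + j) ∧ c (p i) (p j) = κ) :
    A.card + colorDeg n c (p i) ≤ n + 1 := by
  refine le_trans (Nat.add_le_add_right ?_ _) (card_eq_add_colorDeg_le (p i) κ)
  refine Finset.card_le_card_of_injOn p (fun j hj => ?_) fun j hj j' hj' h =>
    hp.inj _ (hA j hj).1 _ (hA j' hj').1 h
  obtain ⟨h1, h2, h3⟩ := hA j hj
  exact Finset.mem_filter.2 ⟨mem_opposite.2 ((hp.adj_iff hi h1).2 h2), h3⟩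

lemma IsPCSeq.exists_ways (hsym : ∀ u v, c u v = c v u) {k t : ℕ} {p : ℕ → V2 n}
    (hp : IsPCSeq n c k p) (ht : 3 ≤ t) (hk : k % 2 = 0)
    (hend : ∀ w, (KBB n).Adj (p 0) w → c (p 0) w ≠ c (p 0) (p 1) → ∃ i < k, p i = w)
    {m : ℕ} (hm : m + 1 + (t - 1) / 2 ≤ colorDeg n c (p 0)) :
    ∃ W : Finset (ℕ × Bool), (∀ a ∈ W, IsWay n c k t p a.1 a.2) ∧ W.card = m := by
  classical
  rcases Nat.eq_zero_or_pos k with rfl | hk0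
  · have h1 := (colorDeg_le_card_ne_add_one (c := c) (p 0) (c (p 0) (p 1)))
    have h2 : ((opposite (p 0)).filter fun w => c (p 0) w ≠ c (p 0) (p 1)) = ∅ := by
      refine Finset.filter_eq_empty_iff.2 fun w hw h => ?_
      obtain ⟨i, hi, -⟩ := hend w (mem_opposite.1 hw) h
      omega
    rw [h2, Finset.card_empty] at h1
    omega
  let X := (Finset.range k).filter fun x => x % 2 = 1 ∧ c (p 0) (p x) ≠ c (p 0) (p 1)
  have hX : colorDeg n c (p 0) ≤ X.card + 1 := by
    refine (colorDeg_le_card_ne_add_one (p 0) (c (p 0) (p 1))).trans (Nat.add_le_add_right ?_ 1)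
    refine le_trans (Finset.card_le_card fun w hw => ?_) (Finset.card_image_le (f := p))
    obtain ⟨hw1, hw2⟩ := Finset.mem_filter.1 hw
    rw [mem_opposite] at hw1
    obtain ⟨i, hi, rfl⟩ := hend w hw1 hw2
    have := (hp.adj_iff hk0 hi).1 hw1
    rw [zero_add, Nat.not_even_iff] at this
    exact Finset.mem_image_of_mem _ (by simp [X, hi, hw2, this])
  let Y := X.filter fun x => t ≤ x + 1 ∧ x + 3 ≤ k
  have hY : X.card ≤ Y.card + (t - 1) / 2 := by
    have h1 : X ⊆ Y ∪ (Finset.range ((t - 1) / 2)).image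
        (fun j => if j = 0 then k - 1 else 1 + 2 * j) := by
      intro x hx
      have hx' := hx
      simp only [X, Finset.mem_filter, Finset.mem_range] at hx'
      obtain ⟨hxk, hx1, hx2⟩ := hx'
      have hx3 : x ≠ 1 := by rintro rfl; exact hx2 rfl
      by_cases h : t ≤ x + 1 ∧ x + 3 ≤ k
      · exact Finset.mem_union_left _ (Finset.mem_filter.2 ⟨hx, h⟩)
      refine Finset.mem_union_right _ (Finset.mem_image.2 ?_)
      by_cases h' : x + 3 ≤ k
      · exact ⟨x / 2, Finset.mem_range.2 (by omega), by rw [if_neg] <;> omega⟩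
      · exact ⟨0, Finset.mem_range.2 (by omega), by rw [if_pos rfl]; omega⟩
    refine (Finset.card_le_card h1).trans ((Finset.card_union_le _ _).trans ?_)
    exact Nat.add_le_add_left (Finset.card_image_le.trans (by simp)) _
  let f : ℕ → ℕ × Bool := fun x =>
    if c (p 0) (p x) ≠ c (p x) (p (x + 1)) then (x - 1, true) else (x + 1, false)
  have hYmem : ∀ x ∈ Y, x % 2 = 1 ∧ 3 ≤ x ∧ x + 3 ≤ k ∧ t ≤ x + 1 ∧
      c (p 0) (p x) ≠ c (p 0) (p 1) := by
    intro x hx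
    simp only [Y, X, Finset.mem_filter, Finset.mem_range] at hx
    have hx3 : x ≠ 1 := by rintro rfl; exact hx.1.2.2 rfl
    exact ⟨hx.1.2.1, by omega, hx.2.2, hx.2.1, hx.1.2.2⟩
  have hinj : Set.InjOn f Y := by
    intro x hx y hy hxy
    have h1 := hYmem x hx
    have h2 := hYmem y hy
    simp only [f] at hxy
    split_ifs at hxy <;> simp only [Prod.mk.injEq] at hxy
    all_goals first | omega | exact absurd hxy.2 (by decide)
  have hway : ∀ a ∈ Y.image f, IsWay n c k t p a.1 a.2 := by
    intro a ha
    obtain ⟨x, hx, rfl⟩ := Finset.mem_image.1 ha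
    obtain ⟨h1, h2, h3, h4, h5⟩ := hYmem x hx
    obtain ⟨z, rfl⟩ : ∃ z, x = z + 1 := ⟨x - 1, by omega⟩
    by_cases h : c (p 0) (p (z + 1)) ≠ c (p (z + 1)) (p (z + 1 + 1))
    · simp only [f, if_pos h]
      exact ⟨by omega, by omega, by omega, h5, h⟩
    · simp only [f, if_neg h]
      refine ⟨by omega, by omega, by omega, by omega, h5, ?_⟩
      rw [not_not] at h
      change c (p 0) (p (z + 1)) ≠ c (p (z + 1)) (p z)
      rw [h, hsym (p (z + 1)) (p z)]
      exact (hp.pc z (by omega)).symm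
  obtain ⟨W, hW, hcard⟩ := Finset.exists_subset_card_eq (s := Y.image f) (n := m)
    (by rw [Finset.card_image_of_injOn hinj]; omega)
  exact ⟨W, fun a ha => hway a (hW ha), hcard⟩

lemma IsPCSeq.wayColor_ne (hsym : ∀ u v, c u v = c v u) {k t : ℕ} {p : ℕ → V2 n}
    (hp : IsPCSeq n c k p) {u : ℕ} (h : IsWay n c k t p u true) :
    wayColor c p (u, true) ≠ wayColor c p (u, false) := by
  obtain ⟨-, h1, h2, -⟩ := h
  obtain ⟨z, rfl⟩ : ∃ z, u = z + 1 := ⟨u - 1, by omega⟩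
  change c (p (z + 1)) (p z) ≠ c (p (z + 1)) (p (z + 1 + 1))
  rw [hsym (p (z + 1)) (p z)]
  exact hp.pc z (by omega)

lemma IsPCSeq.exists_factor (hsym : ∀ u v, c u v = c v u) {k t : ℕ} {p : ℕ → V2 n}
    (hp : IsPCSeq n c k p) (ht : 3 ≤ t) (hk : k % 2 = 0)
    (hdeg : ∀ v, 2 * n + 3 * t ≤ 3 * colorDeg n c v)
    (hend₀ : ∀ w, (KBB n).Adj (p 0) w → c (p 0) w ≠ c (p 0) (p 1) → ∃ i < k, p i = w)
    (hend₁ : ∀ w, (KBB n).Adj (p (k - 1)) w → c (p (k - 1)) w ≠ c (p (k - 1)) (p (k - 1 - 1)) →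
      ∃ i < k, p (k - 1 - i) = w) :
    ∃ F, IsFactorOn n c {v | ∃ i < k, p i = v} F t := by
  classical
  by_contra hno
  have hr := hp.reverse hsym
  have hDn : (2 * n + 3 * t + 2) / 3 ≤ n := by
    have h1 := hdeg (p 0)
    have h2 := colorDeg_eq (c := c) (p 0)
    have h3 := Finset.card_image_le (s := opposite (p 0)) (f := c (p 0))
    rw [card_opposite] at h3
    omega
  have hD : ∀ v, (2 * n + 3 * t + 2) / 3 ≤ colorDeg n c v := fun v => by
    have := hdeg v
    omega
  obtain ⟨D, hD'⟩ : ∃ D, D = (2 * n + 3 * t + 2) / 3 := ⟨_, rfl⟩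
  rw [← hD'] at hDn
  simp only [← hD'] at hD
  have hm : ∀ v, D - 1 - (t - 1) / 2 + 1 + (t - 1) / 2 ≤ colorDeg n c v := fun v => by
    have := hD v
    omega
  obtain ⟨S, hS, cS⟩ := hp.exists_ways hsym ht hk hend₀ (hm _)
  obtain ⟨T, hT, cT⟩ := hr.exists_ways hsym ht hk hend₁ (hm _)
  have memS : ∀ u ∈ S.image Prod.fst, u % 2 = 0 ∧ 2 ≤ u ∧ u + 2 ≤ k := by
    intro u hu
    obtain ⟨a, ha, rfl⟩ := Finset.mem_image.1 hu
    exact (hS a ha).bounds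
  have memT : ∀ v ∈ T.image Prod.fst, v % 2 = 0 ∧ 2 ≤ v ∧ v + 2 ≤ k := by
    intro u hu
    obtain ⟨a, ha, rfl⟩ := Finset.mem_image.1 hu
    exact (hT a ha).bounds
  refine card_ways_lt (q := n + 1 - D) (h := (t - 1) / 2) (C := fun u v => c (p u) (p (k - 1 - v)))
    (colS := wayColor c p) (colT := wayColor c fun i => p (k - 1 - i)) (near := IsNear k t)
    (by omega) (by omega) (fun u h _ => hp.wayColor_ne hsym (hS _ h))
    (fun u h _ => hr.wayColor_ne hsym (hT _ h)) ?_ ?_ ?_ ?_ ?_ cS cT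
  · intro a ha b hb hn
    by_contra! h
    exact hno (IsWay.exists_factor hsym hp ht hk (hS a ha) (hT b hb) hn h.1 h.2)
  · intro a ha A hA h
    have hu := (hS a ha).bounds
    have h1 := hr.card_add_colorDeg_le (i := k - 1 - a.1) (by omega) (wayColor c p a) A (by
      intro j hj
      have := memT j (hA hj)
      refine ⟨by omega, by rw [Nat.not_even_iff]; omega, ?_⟩
      rw [show k - 1 - (k - 1 - a.1) = a.1 by omega]
      exact h j hj)
    have h2 := hD (p (k - 1 - (k - 1 - a.1)))
    omega
  · intro b hb A hA h
    have hv := (hT b hb).bounds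
    have h1 := hp.card_add_colorDeg_le (i := k - 1 - b.1) (by omega)
      (wayColor c (fun i => p (k - 1 - i)) b) A (by
      intro j hj
      have := memS j (hA hj)
      refine ⟨by omega, by rw [Nat.not_even_iff]; omega, ?_⟩
      rw [hsym]
      exact h j hj)
    have h2 := hD (p (k - 1 - b.1))
    omega
  · intro a ha A hA h
    exact card_isNear_le hk (hS a ha).bounds A fun v hv => ⟨memT v (hA hv), h v hv⟩
  · intro b hb A hA h
    refine card_isNear_le hk (hT b hb).bounds A fun u hu => ⟨memS u (hA hu), ?_⟩
    have := h u hu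
    unfold IsNear at this ⊢
    omega

/-- The concatenation of the first `L` terms of `q` with `p`. -/
def appendSeq (L : ℕ) (q p : ℕ → V2 n) : ℕ → V2 n := fun i => if i < L then q i else p (i - L)

lemma exists_appendSeq_eq_iff {L k : ℕ} {q p : ℕ → V2 n} {v : V2 n} :
    (∃ i < L + k, appendSeq L q p i = v) ↔ (∃ i < L, q i = v) ∨ ∃ i < k, p i = v := by
  unfold appendSeq
  constructor
  · rintro ⟨i, hi, h⟩
    by_cases hL : i < L
    · exact Or.inl ⟨i, hL, by rwa [if_pos hL] at h⟩
    · exact Or.inr ⟨i - L, by omega, by rwa [if_neg hL] at h⟩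
  · rintro (⟨i, hi, h⟩ | ⟨i, hi, h⟩)
    · exact ⟨i, by omega, by rwa [if_pos hi]⟩
    · exact ⟨L + i, by omega, by rw [if_neg (by omega), Nat.add_sub_cancel_left]; exact h⟩

lemma IsPCSeq.append {L k : ℕ} {q p : ℕ → V2 n} (hq : IsPCSeq n c (L + 1) q)
    (hp : IsPCSeq n c k p) (hd : ∀ i < L + 1, ∀ j < k, q i ≠ p j)
    (hadj : (KBB n).Adj (q L) (p 0)) (h₁ : 1 ≤ L → c (q (L - 1)) (q L) ≠ c (q L) (p 0))
    (h₂ : c (q L) (p 0) ≠ c (p 0) (p 1)) :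
    IsPCSeq n c (L + 1 + k) (appendSeq (L + 1) q p) := by
  have l : ∀ i < L + 1, appendSeq (L + 1) q p i = q i := fun i hi => if_pos hi
  have r : ∀ i, appendSeq (L + 1) q p (L + 1 + i) = p i := fun i => by
    simp only [appendSeq, Nat.add_sub_cancel_left, ite_eq_right_iff]
    omega
  refine ⟨fun i hi j hj hij => ?_, fun i hi => ?_, fun i hi => ?_⟩
  · rcases Nat.lt_or_ge i (L + 1) with h | h <;> rcases Nat.lt_or_ge j (L + 1) with h' | h'
    · rw [l i h, l j h'] at hij
      exact hq.inj _ h _ h' hij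
    · obtain ⟨j, rfl⟩ := Nat.exists_eq_add_of_le h'
      rw [l i h, r] at hij
      exact absurd hij (hd i h j (by omega))
    · obtain ⟨i, rfl⟩ := Nat.exists_eq_add_of_le h
      rw [l j h', r] at hij
      exact absurd hij.symm (hd j h' i (by omega))
    · obtain ⟨i, rfl⟩ := Nat.exists_eq_add_of_le h
      obtain ⟨j, rfl⟩ := Nat.exists_eq_add_of_le h'
      rw [r, r] at hij
      rw [hp.inj i (by omega) j (by omega) hij]
  · rcases Nat.lt_or_ge i L with h | h
    · rw [l i (by omega), l _ (by omega)]
      exact hq.adj i (by omega)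
    rcases Nat.eq_or_lt_of_le h with rfl | h
    · rw [l _ (by omega), show L + 1 = L + 1 + 0 from rfl, r]
      exact hadj
    · obtain ⟨i, rfl⟩ := Nat.exists_eq_add_of_le (show L + 1 ≤ i from h)
      rw [r, add_assoc (L + 1), r]
      exact hp.adj i (by omega)
  · rcases Nat.lt_or_ge (i + 1) L with h | h
    · rw [l i (by omega), l _ (by omega), l _ (by omega)]
      exact hq.pc i (by omega)
    rcases Nat.eq_or_lt_of_le h with rfl | h
    · rw [l _ (by omega), l _ (by omega), show i + 2 = i + 1 + 1 + 0 from rfl, r]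
      exact h₁ (by omega)
    rcases Nat.eq_or_lt_of_le (show L ≤ i by omega) with rfl | h
    · rw [l _ (by omega), show L + 1 = L + 1 + 0 from rfl, r,
        show L + 2 = L + 1 + 1 from rfl, r]
      exact h₂
    · obtain ⟨i, rfl⟩ := Nat.exists_eq_add_of_le (show L + 1 ≤ i from h)
      rw [r, add_assoc (L + 1), add_assoc (L + 1), r, r]
      exact hp.pc i (by omega)

lemma isPCSeq_const (v : V2 n) : IsPCSeq n c 1 fun _ => v :=
  ⟨fun i hi j hj _ => by omega, fun i hi => by omega, fun i hi => by omega⟩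

lemma IsPCCycle.neg (hsym : ∀ u v, c u v = c v u) {L : ℕ} {f : ZMod L → V2 n}
    (hf : IsPCCycle n c L f) : IsPCCycle n c L fun j => f (-j) := by
  obtain ⟨h1, h2, h3⟩ := hf
  refine ⟨fun a b h => neg_injective (h1 h), fun i => ?_, fun i => ?_⟩
  · have := (h2 (-(i + 1))).symm
    rwa [show -(i + 1) + 1 = -i by ring] at this
  · have := h3 (-(i + 2))
    rw [show -(i + 2) + 1 = -(i + 1) by ring, show -(i + 2) + 2 = -i by ring] at this
    change c (f (-i)) (f (-(i + 1))) ≠ c (f (-(i + 1))) (f (-(i + 2)))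
    rw [hsym (f (-i)), hsym (f (-(i + 1))) (f (-(i + 2)))]
    exact this.symm

lemma IsPCCycle.isPCSeq {L : ℕ} {f : ZMod L → V2 n} (hf : IsPCCycle n c L f) (a : ZMod L) :
    IsPCSeq n c L fun s => f (a + s) := by
  obtain ⟨h1, h2, h3⟩ := hf
  refine ⟨fun i hi j hj h => ?_, fun i hi => ?_, fun i hi => ?_⟩
  · have := (ZMod.natCast_eq_natCast_iff' _ _ _).1 (add_left_cancel (h1 h))
    rwa [Nat.mod_eq_of_lt hi, Nat.mod_eq_of_lt hj] at this
  · have := h2 (a + i)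
    push_cast
    rwa [← add_assoc]
  · have := h3 (a + i)
    push_cast
    rwa [← add_assoc, ← add_assoc]

/-- A properly colored cycle can be traversed as a path ending at any of its vertices, so that the
last edge avoids a given color. -/
lemma IsPCCycle.exists_isPCSeq (hsym : ∀ u v, c u v = c v u) {L : ℕ} {f : ZMod (L + 2) → V2 n}
    (hf : IsPCCycle n c (L + 2) f) (j : ZMod (L + 2)) (κ : ℕ) :
    ∃ q, IsPCSeq n c (L + 2) q ∧ (∀ v, (∃ i < L + 2, q i = v) ↔ v ∈ Set.range f) ∧
      q (L + 1) = f j ∧ c (q L) (q (L + 1)) ≠ κ := by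
  have key : ∀ (f : ZMod (L + 2) → V2 n), IsPCCycle n c (L + 2) f → ∀ j : ZMod (L + 2),
      c (f (j - 1)) (f j) ≠ κ →
      ∃ q, IsPCSeq n c (L + 2) q ∧ (∀ v, (∃ i < L + 2, q i = v) ↔ v ∈ Set.range f) ∧
        q (L + 1) = f j ∧ c (q L) (q (L + 1)) ≠ κ := by
    intro f hf j hj
    have hz : ((L : ℕ) : ZMod (L + 2)) + 2 = 0 := by
      have := ZMod.natCast_self (L + 2)
      push_cast at this
      exact this
    have e1 : j + 1 + ((L + 1 : ℕ) : ZMod (L + 2)) = j := by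
      push_cast
      linear_combination hz
    have e2 : j + 1 + (L : ZMod (L + 2)) = j - 1 := by linear_combination hz
    refine ⟨_, hf.isPCSeq (j + 1), fun v => ⟨?_, ?_⟩, ?_, ?_⟩
    · rintro ⟨i, -, rfl⟩
      exact ⟨_, rfl⟩
    · rintro ⟨i, rfl⟩
      exact ⟨(i - (j + 1)).val, ZMod.val_lt _, by simp⟩
    · simp only [e1]
    · simpa only [e1, e2] using hj
  by_cases h : c (f (j - 1)) (f j) = κ
  · obtain ⟨q, h1, h2, h3, h4⟩ := key _ (hf.neg hsym) (-j) (by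
      have := hf.2.2 (j - 1)
      rw [sub_add_cancel, h, show j - 1 + 2 = j + 1 by ring] at this
      rw [neg_neg, show -(-j - 1) = j + 1 by ring, hsym]
      exact this.symm)
    refine ⟨q, h1, fun v => (h2 v).trans ?_, by simpa using h3, h4⟩
    exact ⟨fun ⟨i, hi⟩ => ⟨-i, hi⟩, fun ⟨i, hi⟩ => ⟨-i, by simpa using hi⟩⟩
  · exact key f hf j h

lemma mem_map_range_iff {k : ℕ} {p : ℕ → V2 n} {v : V2 n} :
    v ∈ (List.range k).map p ↔ ∃ i < k, p i = v := by
  simp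

/-- In an optimal `1^{(t)}`-path-cycle, all the neighbors of the first vertex of the path that are
joined to it by a color other than that of the first edge lie on the path. -/
lemma OnePathCycleT.mem_path_of_adj {t : ℕ} (hsym : ∀ u v, c u v = c v u) (ht : 3 ≤ t)
    (H : OnePathCycleT n c t)
    (hmaxH : ∀ H' : OnePathCycleT n c t, H'.verts.ncard ≤ H.verts.ncard)
    (hmaxP : ∀ H' : OnePathCycleT n c t,
      H'.verts.ncard = H.verts.ncard → H'.path.length ≤ H.path.length)
    {p : ℕ → V2 n} (hp : IsPCSeq n c H.path.length p)
    (hmem : ∀ v, v ∈ H.path ↔ ∃ i < H.path.length, p i = v) (w : V2 n)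
    (hw : (KBB n).Adj (p 0) w) (hc : c (p 0) w ≠ c (p 0) (p 1)) : w ∈ H.path := by
  by_contra hwP
  rw [hsym (p 0) w] at hc
  by_cases hwC : ∃ i j, H.cyc i j = w
  · obtain ⟨i₀, j₀, rfl⟩ := hwC
    obtain ⟨P, hP, m, L, f, hf, hL, hPf, hff⟩ := H
    simp only at hp hmem hmaxP hw hc hwP i₀ j₀
    obtain ⟨l, hl⟩ : ∃ l, L i₀ = l + 2 := ⟨L i₀ - 2, by have := hL i₀; omega⟩
    obtain ⟨q, hq, hqf, hqw, hqc⟩ : ∃ q, IsPCSeq n c (l + 2) q ∧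
        (∀ v, (∃ i < l + 2, q i = v) ↔ v ∈ Set.range (f i₀)) ∧
        q (l + 1) = f i₀ j₀ ∧ c (q l) (q (l + 1)) ≠ c (f i₀ j₀) (p 0) := by
      have := hf i₀
      revert this
      generalize f i₀ = g at *
      clear * - hl hsym
      generalize L i₀ = a at *
      subst hl
      exact fun h => h.exists_isPCSeq hsym j₀ _
    have hr : IsPCSeq n c (l + 1 + 1 + P.length) (appendSeq (l + 1 + 1) q p) := by
      refine hq.append hp ?_ (by rw [hqw]; exact hw.symm) (fun _ => by rw [hqw]; exact hqw ▸ hqc)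
        (by rw [hqw]; exact hc)
      intro i hi j hj h
      obtain ⟨s, hs⟩ := (hqf (q i)).1 ⟨i, hi, rfl⟩
      exact hPf i₀ s ((hmem _).2 ⟨j, hj, by rw [← h, hs]⟩)
    have hrmem : ∀ v, v ∈ (List.range (l + 1 + 1 + P.length)).map (appendSeq (l + 1 + 1) q p) ↔
        v ∈ Set.range (f i₀) ∨ v ∈ P := fun v => by
      rw [mem_map_range_iff, exists_appendSeq_eq_iff, hqf, hmem]
    cases m with
    | zero => exact i₀.elim0
    | succ m =>
      let H' : OnePathCycleT n c t :=
        { path := _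
          path_pc := hr.isPCPath (by omega)
          numCycles := m
          cycLen := fun i => L (i₀.succAbove i)
          cyc := fun i => f (i₀.succAbove i)
          cyc_pc := fun i => hf _
          cyc_long := fun i => hL _
          disj_path_cyc := fun i j h => by
            rcases (hrmem _).1 h with ⟨s, hs⟩ | h
            · exact hff _ _ (Fin.succAbove_ne i₀ i).symm s j hs
            · exact hPf _ _ h
          disj_cyc_cyc := fun i i' h => hff _ _ fun h' => h (Fin.succAbove_right_injective h') }
      have hverts : H'.verts = (⟨P, hP, m + 1, L, f, hf, hL, hPf, hff⟩ :
          OnePathCycleT n c t).verts := by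
        ext v
        simp only [OnePathCycleT.verts, Set.mem_union, Set.mem_ofPred_eq, Set.mem_iUnion, H',
          hrmem, Fin.exists_iff_succAbove i₀ (P := fun i => v ∈ Set.range (f i))]
        tauto
      have := hmaxP H' (by rw [hverts])
      simp only [H', List.length_map, List.length_range] at this
      omega
  · push Not at hwC
    have hr : IsPCSeq n c (0 + 1 + H.path.length) (appendSeq (0 + 1) (fun _ => w) p) :=
      (isPCSeq_const w).append hp (fun i hi j hj h => hwP ((hmem w).2 ⟨j, hj, h.symm⟩))
        hw.symm (by omega) hc
    have hrmem : ∀ v, v ∈ (List.range (0 + 1 + H.path.length)).map (appendSeq (0 + 1) (fun _ => w) p) ↔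
        v = w ∨ v ∈ H.path := fun v => by
      rw [mem_map_range_iff, exists_appendSeq_eq_iff, hmem]
      exact or_congr_left ⟨fun ⟨i, _, h⟩ => h.symm, fun h => ⟨0, by omega, h.symm⟩⟩
    let H' : OnePathCycleT n c t :=
      { H with
        path := _
        path_pc := hr.isPCPath (by omega)
        disj_path_cyc := fun i j h => ((hrmem _).1 h).elim (hwC i j) (H.disj_path_cyc i j) }
    have hverts : H'.verts = insert w H.verts := by
      ext v
      simp only [OnePathCycleT.verts, Set.mem_union, Set.mem_ofPred_eq, Set.mem_iUnion, H',
        hrmem, Set.mem_insert_iff]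
      tauto
    have hwH : w ∉ H.verts := by
      rintro (h | h)
      · exact hwP h
      · obtain ⟨i, j, h⟩ := Set.mem_iUnion.1 h
        exact hwC i j h
    have := hmaxH H'
    rw [hverts, Set.ncard_insert_of_notMem hwH (Set.toFinite _)] at this
    omega

lemma OnePathCycleT.exists_factor {t : ℕ} (hsym : ∀ u v, c u v = c v u) (ht : 3 ≤ t)
    (hdeg : ∀ v, 2 * n + 3 * t ≤ 3 * colorDeg n c v) (H : OnePathCycleT n c t)
    (hmaxH : ∀ H' : OnePathCycleT n c t, H'.verts.ncard ≤ H.verts.ncard)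
    (hmaxP : ∀ H' : OnePathCycleT n c t,
      H'.verts.ncard = H.verts.ncard → H'.path.length ≤ H.path.length)
    (heven : Even H.path.length) : ∃ F, IsFactorOn n c H.verts F t := by
  obtain ⟨p, hp, hmem⟩ := H.path_pc.exists_seq
  have hlen : 0 < H.path.length := List.length_pos_iff.2 H.path_pc.1
  have hr := hp.reverse hsym
  have hrmem : ∀ v, v ∈ (List.range H.path.length).map (fun i => p (H.path.length - 1 - i)) ↔
      v ∈ H.path := by
    intro v
    rw [mem_map_range_iff, hmem]
    constructor
    · rintro ⟨i, hi, h⟩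
      exact ⟨_, by omega, h⟩
    · rintro ⟨i, hi, h⟩
      exact ⟨H.path.length - 1 - i, by omega,
        by rwa [show H.path.length - 1 - (H.path.length - 1 - i) = i by omega]⟩
  let R : OnePathCycleT n c t :=
    { H with
      path := _
      path_pc := hr.isPCPath hlen
      disj_path_cyc := fun i j h => H.disj_path_cyc i j ((hrmem _).1 h) }
  have hRlen : R.path.length = H.path.length := by simp [R]
  have hRverts : R.verts = H.verts := by
    ext v
    simp only [OnePathCycleT.verts, Set.mem_union, Set.mem_ofPred_eq, R, hrmem]
  obtain ⟨F, hF⟩ := hp.exists_factor hsym ht (Nat.even_iff.1 heven) hdeg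
    (fun w h h' => (hmem w).1 (H.mem_path_of_adj hsym ht hmaxH hmaxP hp hmem w h h'))
    (fun w h h' => by
      have := R.mem_path_of_adj hsym ht (by rwa [hRverts]) (by rwa [hRverts, hRlen])
        (by rwa [hRlen]) (fun v => by rw [hRlen]; exact mem_map_range_iff) w h h'
      exact mem_map_range_iff.1 this)
  obtain ⟨F', hF'⟩ := exists_factor_cycles H hsym ht
  rw [show {v | ∃ i < H.path.length, p i = v} = {v | v ∈ H.path} by ext v; exact (hmem v).symm] at hF
  refine ⟨_, hF.sup hF' (Set.disjoint_left.2 fun v hv hv' => ?_)⟩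
  obtain ⟨i, j, rfl⟩ := Set.mem_iUnion.1 hv'
  exact H.disj_path_cyc i j hv

end

/-- Lemma 2.1.  Let `t ≥ 3` and let `G = K^c_{n,n}` satisfy
`δ^c(G) ≥ 2n/3 + t` and contain no PC `2^{(t)}`-factor.  If `H` is a `1^{(t)}`-path-cycle
chosen with `|V(H)|` maximum and, subject to that, the path `P` as long as possible, and
`k = |V(P)|` is even, then `G[V(H)]` has a PC `2^{(t)}`-factor. -/
theorem induced_pc_two_factor (n t : ℕ) (ht : 3 ≤ t)
    (c : V2 n → V2 n → ℕ) (hsym : ∀ u v, c u v = c v u)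
    (hdeg : ∀ v, (2 * n : ℝ) / 3 + t ≤ (colorDeg n c v : ℝ))
    (hno : ¬∃ F : SimpleGraph (V2 n), IsPC2Factor n c F ∧ CyclesAtLeast F t)
    (H : OnePathCycleT n c t)
    (hmaxH : ∀ H' : OnePathCycleT n c t, H'.verts.ncard ≤ H.verts.ncard)
    (hmaxP : ∀ H' : OnePathCycleT n c t,
      H'.verts.ncard = H.verts.ncard → H'.path.length ≤ H.path.length)
    (heven : Even H.path.length) :
    ∃ F : SimpleGraph (V2 n), IsPC2FactorOn n c H.verts F t := by
  have hdeg' : ∀ v, 2 * n + 3 * t ≤ 3 * colorDeg n c v := fun v => by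
    have h := hdeg v
    have : ((2 * n + 3 * t : ℕ) : ℝ) ≤ (3 * colorDeg n c v : ℕ) := by
      push_cast
      linarith
    exact_mod_cast this
  obtain ⟨F, hF⟩ := H.exists_factor hsym ht hdeg' hmaxH hmaxP heven
  exact ⟨F, hF.isPC2FactorOn⟩
end
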